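/- arXiv:1903.08139 — 5 statements merged into one kernel-verified Lean document; each statement's English description precedes it below -/
import Mathlib

section
/- Let Ω ⊆ ℝⁿ be a bounded convex open set and φ : ∂Ω → ℝ ∪ {+∞} a lower semicontinuous function that is convex on every line segment in ∂Ω. Then the effective domain of the convex envelope of φ equals the convex hull of the effective domain of φ in ℝⁿ. -/
open Set Filter Topology
open scoped RealInnerProductSpace

noncomputable section

abbrev En (n : ℕ) := EuclideanSpace ℝ (Fin n)

/-- The convex envelope of `φ`: the pointwise supremum of all affine functions
`x ↦ ⟪x, y⟫ + η` majorized by `φ` on `S`. -/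
def convEnv {n : ℕ} (S : Set (En n)) (φ : En n → EReal) (x : En n) : EReal :=
  ⨆ p : {p : En n × ℝ // ∀ z ∈ S, ((⟪z, p.1⟫ + p.2 : ℝ) : EReal) ≤ φ z},
    ((⟪x, p.1.1⟫ + p.1.2 : ℝ) : EReal)

/-- In a finite-dimensional space, the convex hull of a compact set is compact. -/
theorem isCompact_convexHull {E : Type*} [NormedAddCommGroup E] [NormedSpace ℝ E]
    [FiniteDimensional ℝ E] {s : Set E} (hs : IsCompact s) : IsCompact (convexHull ℝ s) := by
  have heq : convexHull ℝ s = ⋃ k ∈ Iic (Module.finrank ℝ E + 1),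
      (fun p : (Fin k → ℝ) × (Fin k → E) => ∑ i, p.1 i • p.2 i) ''
        (stdSimplex ℝ (Fin k) ×ˢ univ.pi fun _ => s) := by
    refine Subset.antisymm (fun x hx => ?_) (iUnion₂_subset fun k _ => ?_)
    · obtain ⟨ι, _, z, w, hz, hai, hw, hw1, rfl⟩ := eq_pos_convex_span_of_mem_convexHull hx
      let e := (Fintype.equivFin ι).symm
      refine mem_iUnion₂.2 ⟨Fintype.card ι,
        hai.card_le_finrank_succ.trans (Nat.succ_le_succ (Submodule.finrank_le _)),
        (w ∘ e, z ∘ e), ⟨⟨fun i => (hw _).le, ?_⟩, fun i _ => hz (mem_range_self _)⟩, ?_⟩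
      · exact (e.sum_comp w).trans hw1
      · exact e.sum_comp fun i => w i • z i
    · rintro _ ⟨⟨w, z⟩, ⟨⟨hw, hw1⟩, hz⟩, rfl⟩
      exact mem_convexHull_of_exists_fintype w z hw hw1 (fun i => hz i (mem_univ i)) rfl
  rw [heq]
  refine (finite_Iic _).isCompact_biUnion fun k _ => ?_
  exact ((isCompact_stdSimplex ℝ (Fin k)).prod (isCompact_univ_pi fun _ => hs)).image
    (by fun_prop)

/-- A lower semicontinuous function on a compact set that avoids `⊥` has a real lower bound. -/
theorem exists_real_lower_bound {X : Type*} [TopologicalSpace X] {S : Set X} (hS : IsCompact S)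
    {φ : X → EReal} (hlsc : LowerSemicontinuousOn φ S) (hbot : ∀ x ∈ S, φ x ≠ ⊥) :
    ∃ m : ℝ, ∀ z ∈ S, (m : EReal) ≤ φ z := by
  rcases S.eq_empty_or_nonempty with rfl | hne
  · exact ⟨0, by simp⟩
  · obtain ⟨a, ha, hmin⟩ := hlsc.exists_isMinOn hne hS
    obtain ⟨m, -, hm⟩ := EReal.lt_iff_exists_real_btwn.1 (bot_lt_iff_ne_bot.2 (hbot a ha))
    exact ⟨m, fun z hz => hm.le.trans (hmin hz)⟩

/-- The pairs `(z, s)` with `0 ≤ s ≤ 1 / (φ z - m + 1)`, written without division. -/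
def truncatedHypograph {X : Type*} (S : Set X) (φ : X → EReal) (m : ℝ) : Set (X × ℝ) :=
  {p | p ∈ S ×ˢ Icc (0 : ℝ) 1 ∧ ∀ c : ℝ, (c : EReal) < φ p.1 → p.2 * (c - m + 1) ≤ 1}

theorem isCompact_truncatedHypograph {X : Type*} [TopologicalSpace X] {S : Set X}
    (hS : IsCompact S) {φ : X → EReal} (hlsc : LowerSemicontinuousOn φ S) (m : ℝ) :
    IsCompact (truncatedHypograph S φ m) := by
  have hsub (c : ℝ) : ∃ v : Set X, IsClosed v ∧ S ∩ φ ⁻¹' Iic (c : EReal) = S ∩ v :=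
    lowerSemicontinuousOn_iff_preimage_Iic.1 hlsc c
  choose v hv hSv using hsub
  have heq : truncatedHypograph S φ m = (S ×ˢ Icc (0 : ℝ) 1) ∩
      ⋂ c : ℝ, (Prod.fst ⁻¹' v c ∪ {p : X × ℝ | p.2 * (c - m + 1) ≤ 1}) := by
    ext ⟨z, s⟩
    simp only [truncatedHypograph, mem_ofPred_eq, mem_inter_iff, mem_iInter, mem_union,
      mem_preimage]
    refine and_congr_right fun hz => forall_congr' fun c => ?_
    have hmem : φ z ≤ c ↔ z ∈ v c := by
      have := Set.ext_iff.1 (hSv c) z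
      simpa [hz.1] using this
    rw [← hmem, imp_iff_not_or, not_lt]
  rw [heq]
  refine (hS.prod isCompact_Icc).inter_right (isClosed_iInter fun c => ?_)
  exact ((hv c).preimage continuous_fst).union
    (isClosed_le (by fun_prop) continuous_const)

theorem ne_top_of_mem_truncatedHypograph {X : Type*} {S : Set X} {φ : X → EReal} {m : ℝ}
    {p : X × ℝ} (hp : p ∈ truncatedHypograph S φ m) (hs : 0 < p.2) : φ p.1 ≠ ⊤ := by
  intro h
  have := hp.2 (m + 1 / p.2) (by rw [h]; exact EReal.coe_lt_top _)
  have h2 : p.2 * (m + 1 / p.2 - m + 1) = 1 + p.2 := by field_simp; ring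
  linarith

open scoped Pointwise in
/-- Convex combinations of points `(s • z, s)` of the cone over `C` stay in that cone. -/
theorem convex_cone_over {E : Type*} [AddCommGroup E] [Module ℝ E] {C : Set E}
    (hC : Convex ℝ C) : Convex ℝ {p : E × ℝ | 0 ≤ p.2 ∧ p.1 ∈ p.2 • C} := by
  rintro ⟨v, s⟩ ⟨hs, hv⟩ ⟨w, t⟩ ⟨ht, hw⟩ a b ha hb -
  simp only at hs hv ht hw
  refine ⟨by simp only [Prod.snd_add, Prod.smul_snd, smul_eq_mul]; positivity, ?_⟩
  simp only [Prod.snd_add, Prod.smul_snd, smul_eq_mul, Prod.fst_add, Prod.smul_fst]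
  rw [hC.add_smul (by positivity) (by positivity), mul_smul, mul_smul]
  exact Set.add_mem_add (Set.smul_mem_smul_set hv) (Set.smul_mem_smul_set hw)

open scoped Pointwise in
/-- Off the convex hull of its effective domain, a lower semicontinuous function on a compact set
has affine minorants of arbitrarily large value. -/
theorem exists_affine_minorant_gt {n : ℕ} {S : Set (En n)} (hS : IsCompact S) {φ : En n → EReal}
    (hlsc : LowerSemicontinuousOn φ S) {m : ℝ} (hm : ∀ z ∈ S, (m : EReal) ≤ φ z) {x : En n}
    (hx : x ∉ convexHull ℝ {z | z ∈ S ∧ φ z ≠ ⊤}) (M : ℝ) :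
    ∃ (y : En n) (η : ℝ), (∀ z ∈ S, ((⟪z, y⟫ + η : ℝ) : EReal) ≤ φ z) ∧ M < ⟪x, y⟫ + η := by
  rcases ({z | z ∈ S ∧ φ z ≠ ⊤} : Set (En n)).eq_empty_or_nonempty with hemp | ⟨z₀, hz₀, hz₀t⟩
  · refine ⟨0, M + 1, fun z hz => ?_, by simp⟩
    have : φ z = ⊤ := by
      by_contra h
      exact (hemp ▸ (show z ∈ {z | z ∈ S ∧ φ z ≠ ⊤} from ⟨hz, h⟩) : z ∈ (∅ : Set (En n)))
    simp [this]
  set C := convexHull ℝ {z | z ∈ S ∧ φ z ≠ ⊤} with hCdef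
  set Q : Set (En n × ℝ) := (fun p : En n × ℝ => (p.2 • p.1, p.2)) '' truncatedHypograph S φ m
    with hQ
  have hQcomp : IsCompact Q :=
    (isCompact_truncatedHypograph hS hlsc m).image (by fun_prop)
  have hz₀C : z₀ ∈ C := subset_convexHull ℝ _ ⟨hz₀, hz₀t⟩
  have hQcone : convexHull ℝ Q ⊆ {p : En n × ℝ | 0 ≤ p.2 ∧ p.1 ∈ p.2 • C} := by
    refine convexHull_min ?_ (convex_cone_over (convex_convexHull ℝ _))
    rintro _ ⟨p, hp, rfl⟩
    refine ⟨hp.1.2.1, ?_⟩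
    rcases hp.1.2.1.eq_or_lt with h | h
    · refine ⟨z₀, hz₀C, ?_⟩
      simp [← h]
    · exact Set.smul_mem_smul_set
        (subset_convexHull ℝ _ ⟨hp.1.1, ne_top_of_mem_truncatedHypograph hp h⟩)
  obtain ⟨ε, hε, hεM⟩ : ∃ ε : ℝ, 0 < ε ∧ M < 1 / ε + m - 1 := by
    refine ⟨1 / (|M - m + 1| + 1), by positivity, ?_⟩
    rw [one_div_one_div]
    linarith [le_abs_self (M - m + 1)]
  have hxQ : (ε • x, ε) ∉ convexHull ℝ Q := fun h =>
    hx ((Set.smul_mem_smul_set_iff₀ hε.ne' C x).1 (hQcone h).2)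
  obtain ⟨f, u, hfu, huf⟩ := geometric_hahn_banach_closed_point (convex_convexHull ℝ Q)
    (isCompact_convexHull hQcomp).isClosed hxQ
  set y : En n := (InnerProductSpace.toDual ℝ (En n)).symm
    (f.comp (ContinuousLinearMap.inl ℝ (En n) ℝ)) with hy
  have hf (v : En n) (s : ℝ) : f (s • v, s) = s * (⟪v, y⟫ + f (0, 1)) := by
    have h1 : ⟪v, y⟫ = f (v, 0) := by
      rw [real_inner_comm, hy, InnerProductSpace.toDual_symm_apply]
      simp
    have h2 : ((s • v, s) : En n × ℝ) = s • ((v, 0) + (0, 1)) := by ext <;> simp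
    rw [h2, map_smul, map_add, h1, smul_eq_mul]
  have hu : 0 < u := by
    have h0 : ((z₀, 0) : En n × ℝ) ∈ truncatedHypograph S φ m :=
      ⟨⟨hz₀, by simp⟩, by simp⟩
    have := hfu _ (subset_convexHull ℝ _ (mem_image_of_mem _ h0))
    simp only [hf] at this
    linarith
  rw [hf] at huf
  refine ⟨u⁻¹ • y, u⁻¹ * f (0, 1) + m - 1, fun z hz => ?_, ?_⟩
  · by_cases hzt : φ z = ⊤
    · simp [hzt]
    have hzb : φ z ≠ ⊥ := fun h => by simpa [h] using hm z hz
    obtain ⟨r, hr⟩ : ∃ r : ℝ, (r : EReal) = φ z := ⟨_, EReal.coe_toReal hzt hzb⟩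
    have hmr : m ≤ r := by
      have := hm z hz
      rw [← hr] at this
      exact_mod_cast this
    have hpos : 0 < r - m + 1 := by linarith
    have hmem : (z, (r - m + 1)⁻¹) ∈ truncatedHypograph S φ m := by
      refine ⟨⟨hz, by positivity, inv_le_one_of_one_le₀ (by linarith)⟩, fun c hc => ?_⟩
      have hcr : c < r := by
        simp only [← hr] at hc
        exact_mod_cast hc
      simp only
      rw [inv_mul_le_iff₀ hpos]
      linarith
    have hlt := hfu _ (subset_convexHull ℝ _ (mem_image_of_mem _ hmem))
    simp only [hf] at hlt
    rw [inv_mul_lt_iff₀ hpos] at hlt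
    rw [← hr, EReal.coe_le_coe_iff, inner_smul_right]
    have : u⁻¹ * (⟪z, y⟫ + f (0, 1)) < r - m + 1 := by
      rw [inv_mul_lt_iff₀ hu]
      linarith
    linarith
  · rw [inner_smul_right]
    have : 1 / ε < u⁻¹ * (⟪x, y⟫ + f (0, 1)) := by
      rw [div_lt_iff₀ hε, mul_assoc, lt_inv_mul_iff₀ hu]
      linarith
    linarith

/-- The convex envelope is finite from above on the convex hull of the effective domain. -/
theorem convEnv_ne_top_of_mem_convexHull {n : ℕ} {S : Set (En n)} {φ : En n → EReal} {x : En n}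
    (hx : x ∈ convexHull ℝ {z | z ∈ S ∧ φ z ≠ ⊤}) : convEnv S φ x ≠ ⊤ := by
  set B : Set (En n) := {x | ∃ c : ℝ, ∀ (y : En n) (η : ℝ),
    (∀ z ∈ S, ((⟪z, y⟫ + η : ℝ) : EReal) ≤ φ z) → ⟪x, y⟫ + η ≤ c} with hB
  have hBconv : Convex ℝ B := by
    rintro v ⟨c, hc⟩ w ⟨d, hd⟩ a b ha hb hab
    refine ⟨a * c + b * d, fun y η h => ?_⟩
    have h1 := mul_le_mul_of_nonneg_left (hc y η h) ha
    have h2 := mul_le_mul_of_nonneg_left (hd y η h) hb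
    rw [inner_add_left, real_inner_smul_left, real_inner_smul_left]
    have h3 : η = a * η + b * η := by rw [← add_mul, hab, one_mul]
    linarith
  have hsub : {z | z ∈ S ∧ φ z ≠ ⊤} ⊆ B := by
    rintro z ⟨hz, hzt⟩
    refine ⟨(φ z).toReal, fun y η h => ?_⟩
    have := (h z hz).trans (EReal.le_coe_toReal hzt)
    exact_mod_cast this
  obtain ⟨c, hc⟩ := convexHull_min hsub hBconv hx
  refine ne_top_of_le_ne_top (EReal.coe_ne_top c) (iSup_le ?_)
  rintro ⟨⟨y, η⟩, h⟩
  exact EReal.coe_le_coe_iff.2 (hc y η h)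

theorem stmt5 {n : ℕ} (Ω : Set (En n)) (hb : Bornology.IsBounded Ω)
    (hc : Convex ℝ Ω) (ho : IsOpen Ω) (φ : En n → EReal)
    (hbot : ∀ x ∈ frontier Ω, φ x ≠ ⊥)
    (hlsc : LowerSemicontinuousOn φ (frontier Ω))
    (hseg : ∀ a b : En n, segment ℝ a b ⊆ frontier Ω →
      Convex ℝ {p : En n × ℝ | p.1 ∈ segment ℝ a b ∧ φ p.1 ≤ (p.2 : EReal)}) :
    {x | convEnv (frontier Ω) φ x ≠ ⊤ ∧ convEnv (frontier Ω) φ x ≠ ⊥} =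
      convexHull ℝ {x | x ∈ frontier Ω ∧ φ x ≠ ⊤} := by
  have hS : IsCompact (frontier Ω) :=
    hb.isCompact_closure.of_isClosed_subset isClosed_frontier frontier_subset_closure
  obtain ⟨m, hm⟩ := exists_real_lower_bound hS hlsc hbot
  have hle (x y : En n) (η : ℝ) (h : ∀ z ∈ frontier Ω, ((⟪z, y⟫ + η : ℝ) : EReal) ≤ φ z) :
      ((⟪x, y⟫ + η : ℝ) : EReal) ≤ convEnv (frontier Ω) φ x :=
    le_iSup (fun p : {p : En n × ℝ // ∀ z ∈ frontier Ω, ((⟪z, p.1⟫ + p.2 : ℝ) : EReal) ≤ φ z} =>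
      ((⟪x, p.1.1⟫ + p.1.2 : ℝ) : EReal)) ⟨(y, η), h⟩
  ext x
  refine ⟨fun hx => ?_, fun hx => ⟨convEnv_ne_top_of_mem_convexHull hx, ?_⟩⟩
  · by_contra hnot
    refine hx.1 (EReal.eq_top_iff_forall_lt _ |>.2 fun M => ?_)
    obtain ⟨y, η, h, hM⟩ := exists_affine_minorant_gt hS hlsc hm hnot M
    exact (EReal.coe_lt_coe_iff.2 hM).trans_le (hle x y η h)
  · exact ne_bot_of_le_ne_bot (EReal.coe_ne_bot _) (hle x 0 m (by simpa using hm))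
end
end

section
/- Let U ⊆ ℝⁿ be a bounded convex open set and u₊, u₋ : U → ℝ convex functions whose Monge–Ampère measures satisfy MA(u₊) ≤ MA(u₋) on Borel subsets of U. Then inf_U (u₊ − u₋) = liminf_{x→∂U} (u₊(x) − u₋(x)), where the right side is the supremum over compact E ⊆ U of inf_{U∖E}(u₊ − u₋). -/
open Set Filter Topology MeasureTheory
open scoped RealInnerProductSpace ENNReal

noncomputable section

/-- The subgradient set of a convex function `u` on `U` at a point `x`. -/
def subgrad {n : ℕ} (U : Set (En n)) (u : En n → ℝ) (x : En n) : Set (En n) :=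
  {y | ∀ z ∈ U, u x + ⟪z - x, y⟫ ≤ u z}

/-- The Monge–Ampère measure of `u` on `U`: the Lebesgue measure of the subgradient
image of a set. -/
def MAmeasure {n : ℕ} (U : Set (En n)) (u : En n → ℝ) (s : Set (En n)) : ℝ≥0∞ :=
  volume (⋃ x ∈ s, subgrad U u x)

section FirmlyNonexpansive

variable {F : Type*} [NormedAddCommGroup F] [InnerProductSpace ℝ F]

lemma norm_sub_apply_sq_le {A : F →L[ℝ] F} (hA : ∀ v, ‖A v‖ ^ 2 ≤ ⟪v, A v⟫) (v : F) :
    ‖v - A v‖ ^ 2 ≤ ‖v‖ ^ 2 - ‖A v‖ ^ 2 := by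
  rw [norm_sub_sq_real]
  linarith [hA v]

lemma norm_fderiv_sq_le_inner {E : Set F} {J : F → F} (hE : IsOpen E)
    (hJ : ∀ p ∈ E, ∀ q ∈ E, ‖J p - J q‖ ^ 2 ≤ ⟪p - q, J p - J q⟫) {q : F} (hq : q ∈ E)
    (hd : DifferentiableAt ℝ J q) (v : F) : ‖fderiv ℝ J q v‖ ^ 2 ≤ ⟪v, fderiv ℝ J q v⟫ := by
  have hl : HasDerivAt (fun t : ℝ ↦ J (q + t • v)) (fderiv ℝ J q v) 0 :=
    hd.hasFDerivAt.hasLineDerivAt v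
  have ht := hl.tendsto_slope_zero
  simp only [zero_add, zero_smul, add_zero] at ht
  have hmem : ∀ᶠ t : ℝ in 𝓝[≠] 0, q + t • v ∈ E := by
    have hcont : Continuous fun t : ℝ ↦ q + t • v := by fun_prop
    exact (hcont.continuousAt.eventually_mem (hE.mem_nhds (by simpa))).filter_mono
      nhdsWithin_le_nhds
  refine le_of_tendsto_of_tendsto (ht.norm.pow 2) (tendsto_const_nhds.inner ht) ?_
  filter_upwards [hmem, self_mem_nhdsWithin] with t ht ht0
  have ht0 : t ≠ 0 := ht0
  have h := hJ _ ht q hq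
  simp only [add_sub_cancel_left, inner_smul_left, RCLike.conj_to_real] at h
  rw [norm_smul, mul_pow, inner_smul_right, Real.norm_eq_abs, sq_abs]
  calc t⁻¹ ^ 2 * ‖J (q + t • v) - J q‖ ^ 2
      ≤ t⁻¹ ^ 2 * (t * ⟪v, J (q + t • v) - J q⟫) := by gcongr
    _ = t⁻¹ * ⟪v, J (q + t • v) - J q⟫ := by field_simp

variable [FiniteDimensional ℝ F] [MeasurableSpace F] [BorelSpace F]

lemma abs_det_le_pow_of_norm_le {B : F →L[ℝ] F} {r : ℝ} (hr : 0 ≤ r) (hB : ∀ v, ‖B v‖ ≤ r * ‖v‖) :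
    |B.det| ≤ r ^ Module.finrank ℝ F := by
  let μ : Measure F := Measure.addHaar
  have hsub : B '' Metric.closedBall 0 1 ⊆ Metric.closedBall 0 r := by
    rintro _ ⟨v, hv, rfl⟩
    rw [mem_closedBall_zero_iff] at hv ⊢
    exact (hB v).trans (mul_le_of_le_one_right hr hv)
  have h := measure_mono (μ := μ) hsub
  rw [Measure.addHaar_image_continuousLinearMap, Measure.addHaar_closedBall' μ 0 hr] at h
  have h1 : μ (Metric.closedBall 0 1) ≠ 0 := (Metric.measure_closedBall_pos μ 0 one_pos).ne'
  have h2 : μ (Metric.closedBall 0 1) ≠ ∞ := measure_closedBall_lt_top.ne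
  rw [ENNReal.mul_le_mul_iff_left h1 h2] at h
  exact (ENNReal.ofReal_le_ofReal_iff (by positivity)).1 h

lemma abs_det_id_sub_le_one {A : F →L[ℝ] F} (hA : ∀ v, ‖A v‖ ^ 2 ≤ ⟪v, A v⟫) :
    |(ContinuousLinearMap.id ℝ F - A).det| ≤ 1 := by
  refine (abs_det_le_pow_of_norm_le zero_le_one fun v ↦ ?_).trans_eq (one_pow _)
  rw [one_mul]
  refine abs_le_of_sq_le_sq' ?_ (norm_nonneg v) |>.2
  have := norm_sub_apply_sq_le hA v
  simp only [sub_apply, ContinuousLinearMap.id_apply]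
  nlinarith [sq_nonneg ‖A v‖]

lemma abs_det_id_sub_lt_one [Nontrivial F] {A : F →L[ℝ] F} (hA : ∀ v, ‖A v‖ ^ 2 ≤ ⟪v, A v⟫)
    (hdet : A.det ≠ 0) : |(ContinuousLinearMap.id ℝ F - A).det| < 1 := by
  have hker : LinearMap.ker (A : F →ₗ[ℝ] F) = ⊥ :=
    LinearMap.ker_eq_bot.2 ((LinearMap.equivOfDetNeZero (A : F →ₗ[ℝ] F) hdet).injective)
  obtain ⟨K, hK, hlip⟩ := LinearMap.exists_antilipschitzWith (A : F →ₗ[ℝ] F) hker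
  have hK' : (0 : ℝ) < K := hK
  have hle : ∀ v, ‖v‖ ≤ K * ‖A v‖ := fun v ↦ by simpa using hlip.le_mul_dist v 0
  set c : ℝ := ((K : ℝ)⁻¹) ^ 2 with hc
  have hc0 : 0 < c := by positivity
  have hAv : ∀ v, c * ‖v‖ ^ 2 ≤ ‖A v‖ ^ 2 := fun v ↦ by
    rw [hc, ← mul_pow]
    gcongr
    rw [inv_mul_le_iff₀ hK']
    exact hle v
  have hkey : ∀ v, ‖(ContinuousLinearMap.id ℝ F - A) v‖ ≤ √(1 - c) * ‖v‖ := fun v ↦ by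
    have h1 := norm_sub_apply_sq_le hA v
    rw [← Real.sqrt_sq (norm_nonneg v), ← Real.sqrt_mul' _ (sq_nonneg _)]
    refine Real.le_sqrt_of_sq_le ?_
    simp only [sub_apply, ContinuousLinearMap.id_apply]
    linarith [hAv v]
  refine (abs_det_le_pow_of_norm_le (Real.sqrt_nonneg _) hkey).trans_lt ?_
  refine pow_lt_one₀ (Real.sqrt_nonneg _) ?_ Module.finrank_pos.ne'
  rw [Real.sqrt_lt' one_pos]
  linarith

lemma LipschitzOnWith.addHaar_image_eq_zero {μ : Measure F} [μ.IsAddHaarMeasure] {K : NNReal}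
    {f : F → F} {s : Set F} (hf : LipschitzOnWith K f s) (hs : μ s = 0) : μ (f '' s) = 0 := by
  let ν : Measure F := Measure.hausdorffMeasure (Module.finrank ℝ F)
  have hνs : ν s = 0 := Measure.absolutelyContinuous_isAddHaarMeasure ν μ hs
  have hν : ν (f '' s) = 0 := by
    refine le_antisymm ((hf.hausdorffMeasure_image_le (Nat.cast_nonneg _)).trans ?_) zero_le
    simp [show Measure.hausdorffMeasure (Module.finrank ℝ F) s = 0 from hνs]
  exact Measure.absolutelyContinuous_isAddHaarMeasure μ ν hν

/-- If `J` is firmly nonexpansive on an open set and its image is not negligible, then `id - J`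
strictly decreases the volume of that set. -/
lemma addHaar_image_id_sub_lt [Nontrivial F] {μ : Measure F} [μ.IsAddHaarMeasure] {E : Set F}
    {J : F → F} (hE : IsOpen E) (hJ : ∀ p ∈ E, ∀ q ∈ E, ‖J p - J q‖ ^ 2 ≤ ⟪p - q, J p - J q⟫)
    (hpos : μ (J '' E) ≠ 0) (hfin : μ E ≠ ∞) : μ ((fun q ↦ q - J q) '' E) < μ E := by
  have hlipJ : LipschitzOnWith 1 J E := by
    refine LipschitzOnWith.of_dist_le_mul fun p hp q hq ↦ ?_
    rw [dist_eq_norm, dist_eq_norm, NNReal.coe_one, one_mul]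
    have h1 := hJ p hp q hq
    have h2 := real_inner_le_norm (p - q) (J p - J q)
    by_contra! h
    nlinarith [norm_nonneg (p - q)]
  have hlip : LipschitzOnWith (1 + 1) (fun q ↦ q - J q) E :=
    (LipschitzWith.id.lipschitzOnWith).sub hlipJ
  set G : Set F := {q ∈ E | DifferentiableAt ℝ J q} with hG
  set N : Set F := {q ∈ E | ¬ DifferentiableAt ℝ J q} with hN
  have hEGN : E = G ∪ N := by ext; simp only [hG, hN, mem_union, mem_ofPred_eq]; tauto
  have hGE : G ⊆ E := sep_subset _ _
  have hNE : N ⊆ E := sep_subset _ _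
  have hGm : MeasurableSet G := hE.measurableSet.inter (measurableSet_of_differentiableAt ℝ J)
  have hN0 : μ N = 0 := by
    have h := hlipJ.ae_differentiableWithinAt_of_mem (μ := μ)
    refine measure_mono_null (fun q hq ↦ ?_) (ae_iff.1 h)
    exact fun hc ↦ hq.2 ((hc hq.1).differentiableAt (hE.mem_nhds hq.1))
  have hfirm := fun q (hq : q ∈ G) ↦ norm_fderiv_sq_le_inner hE hJ hq.1 hq.2
  set P : Set F := {q ∈ G | (fderiv ℝ J q).det ≠ 0} with hP
  have hP0 : μ P ≠ 0 := by
    intro h0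
    refine hpos (measure_mono_null (t := J '' (G \ P) ∪ J '' P ∪ J '' N) ?_ ?_)
    · rw [← image_union, ← image_union, sdiff_union_of_subset (sep_subset _ _), ← hEGN]
    · refine measure_union_null (measure_union_null ?_ ?_) ?_
      · refine addHaar_image_eq_zero_of_det_fderivWithin_eq_zero μ
          (f' := fderiv ℝ J) (fun q hq ↦ hq.1.2.hasFDerivAt.hasFDerivWithinAt) fun q hq ↦ ?_
        by_contra hne
        exact hq.2 ⟨hq.1, hne⟩
      · exact (hlipJ.mono ((sep_subset _ _).trans hGE)).addHaar_image_eq_zero h0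
      · exact (hlipJ.mono hNE).addHaar_image_eq_zero hN0
  have hlt : ∫⁻ q in G, ENNReal.ofReal |(ContinuousLinearMap.id ℝ F - fderiv ℝ J q).det| ∂μ
      < ∫⁻ _ in G, 1 ∂μ := by
    have hle : (fun q ↦ ENNReal.ofReal |(ContinuousLinearMap.id ℝ F - fderiv ℝ J q).det|)
        ≤ᵐ[μ.restrict G] fun _ ↦ 1 := by
      filter_upwards [ae_restrict_mem hGm] with q hq
      exact ENNReal.ofReal_le_one.2 (abs_det_id_sub_le_one (hfirm q hq))
    refine lintegral_strict_mono_of_ae_le_of_ae_lt_on aemeasurable_const ?_ hle (s := P) ?_ ?_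
    · refine ((lintegral_mono_ae hle).trans_lt ?_).ne
      rw [setLIntegral_one]
      exact (measure_mono hGE).trans_lt hfin.lt_top
    · rwa [Measure.restrict_eq_self _ (sep_subset _ _)]
    · exact ae_of_all _ fun q hq ↦
        ENNReal.ofReal_lt_one.2 (abs_det_id_sub_lt_one (hfirm q hq.1) hq.2)
  calc μ ((fun q ↦ q - J q) '' E)
      ≤ μ ((fun q ↦ q - J q) '' G) + μ ((fun q ↦ q - J q) '' N) := by
        conv_lhs => rw [hEGN, image_union]
        exact measure_union_le _ _
    _ = μ ((fun q ↦ q - J q) '' G) := by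
        rw [(hlip.mono hNE).addHaar_image_eq_zero hN0, add_zero]
    _ ≤ ∫⁻ q in G, ENNReal.ofReal |(ContinuousLinearMap.id ℝ F - fderiv ℝ J q).det| ∂μ :=
        addHaar_image_le_lintegral_abs_det_fderiv μ hGm fun q hq ↦
          ((hasFDerivAt_id q).sub hq.2.hasFDerivAt).hasFDerivWithinAt
    _ < μ G := by rwa [setLIntegral_one] at hlt
    _ ≤ μ E := measure_mono hGE

end FirmlyNonexpansive

section Subgradient

variable {n : ℕ} {U : Set (En n)} {u : En n → ℝ}

lemma subgrad_monotone {x y p q : En n} (hx : x ∈ U) (hy : y ∈ U) (hp : p ∈ subgrad U u x)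
    (hq : q ∈ subgrad U u y) : 0 ≤ ⟪p - q, x - y⟫ := by
  have h1 := hp y hy
  have h2 := hq x hx
  rw [real_inner_comm, ← neg_sub x y, inner_neg_right] at h1
  rw [real_inner_comm] at h2
  rw [inner_sub_left]
  linarith

lemma exists_mem_subgrad (ho : IsOpen U) (hu : ConvexOn ℝ U u) {x : En n} (hx : x ∈ U) :
    (subgrad U u x).Nonempty := by
  have hopen : IsOpen {p : En n × ℝ | p.1 ∈ U ∧ u p.1 < p.2} := by
    have hc : ContinuousOn (fun p : En n × ℝ ↦ p.2 - u p.1) (Prod.fst ⁻¹' U) :=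
      continuousOn_snd.sub ((hu.continuousOn ho).comp continuousOn_fst fun p hp ↦ hp)
    convert hc.isOpen_inter_preimage (ho.preimage continuous_fst) (isOpen_Ioi (a := 0)) using 1
    ext p
    simp
  obtain ⟨f, hf⟩ := geometric_hahn_banach_open_point (x := (x, u x)) hu.convex_strict_epigraph hopen
    fun h ↦ lt_irrefl _ h.2
  set c : ℝ := f (0, 1) with hc
  let l : En n →L[ℝ] ℝ := f.comp (ContinuousLinearMap.inl ℝ (En n) ℝ)
  have hfl : ∀ z s, f (z, s) = l z + s * c := fun z s ↦ by
    have : ((z, s) : En n × ℝ) = (z, 0) + s • (0, 1) := by simp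
    rw [this, map_add, map_smul, smul_eq_mul, hc]
    rfl
  have hc0 : c < 0 := by
    have := hf (x, u x + 1) ⟨hx, lt_add_one _⟩
    rw [hfl, hfl] at this
    linarith
  refine ⟨(InnerProductSpace.toDual ℝ (En n)).symm ((-c)⁻¹ • l), fun z hz ↦ ?_⟩
  rw [real_inner_comm, InnerProductSpace.toDual_symm_apply]
  have hle : l z + u z * c ≤ l x + u x * c := by
    have hlim : Tendsto (fun s : ℝ ↦ l z + s * c) (𝓝[>] (u z)) (𝓝 (l z + u z * c)) := by
      have h : Continuous fun s : ℝ ↦ l z + s * c := by fun_prop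
      exact (h.tendsto _).mono_left nhdsWithin_le_nhds
    refine le_of_tendsto hlim ?_
    filter_upwards [self_mem_nhdsWithin] with s hs
    have := hf (z, s) ⟨hz, hs⟩
    rw [hfl, hfl] at this
    exact this.le
  have h : (-c)⁻¹ * (l z - l x) ≤ u z - u x := by
    rw [inv_mul_le_iff₀ (neg_pos.2 hc0)]
    linarith
  simp only [smul_apply, map_sub, smul_eq_mul]
  linarith

/-- A subgradient of `u + (a / 2) * ‖·‖ ^ 2` is shifted by `a • x` from a subgradient of `u`. -/
lemma sub_smul_mem_subgrad (hu : ConvexOn ℝ U u) {x q : En n} {a : ℝ} (hx : x ∈ U)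
    (h : ∀ᶠ w in 𝓝 x, w ∈ U → u x + a / 2 * ‖x‖ ^ 2 + ⟪w - x, q⟫ ≤ u w + a / 2 * ‖w‖ ^ 2) :
    q - a • x ∈ subgrad U u x := by
  intro z hz
  have hcont : Continuous fun t : ℝ ↦ x + t • (z - x) := by fun_prop
  have h0 : Tendsto (fun t : ℝ ↦ x + t • (z - x)) (𝓝[>] 0) (𝓝 x) := by
    have := hcont.tendsto 0
    simp only [zero_smul, add_zero] at this
    exact this.mono_left nhdsWithin_le_nhds
  have hlim : Tendsto (fun t : ℝ ↦ u z + t * (a / 2 * ‖z - x‖ ^ 2)) (𝓝[>] 0) (𝓝 (u z)) := by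
    have hc : Continuous fun t : ℝ ↦ u z + t * (a / 2 * ‖z - x‖ ^ 2) := by fun_prop
    have := hc.tendsto 0
    simp only [zero_mul, add_zero] at this
    exact this.mono_left nhdsWithin_le_nhds
  refine ge_of_tendsto hlim ?_
  filter_upwards [h0.eventually h, Ioo_mem_nhdsGT (zero_lt_one' ℝ)] with t ht ht01
  have hw : x + t • (z - x) = (1 - t) • x + t • z := by module
  have h1 : x + t • (z - x) ∈ U := by
    rw [hw]; exact hu.1 hx hz (by linarith [ht01.2]) ht01.1.le (by ring)
  have h2 : u (x + t • (z - x)) ≤ (1 - t) * u x + t * u z := by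
    rw [hw]; exact hu.2 hx hz (by linarith [ht01.2]) ht01.1.le (by ring)
  have h3 := ht h1
  rw [norm_add_sq_real, add_sub_cancel_left, inner_smul_left, inner_smul_right, norm_smul,
    mul_pow, Real.norm_eq_abs, sq_abs, RCLike.conj_to_real] at h3
  rw [inner_sub_right, inner_smul_right, real_inner_comm x (z - x)]
  refine le_of_mul_le_mul_left ?_ ht01.1
  nlinarith

lemma add_sq_le_of_sub_smul_mem_subgrad {x q z : En n} {a : ℝ} (h : q - a • x ∈ subgrad U u x)
    (hz : z ∈ U) :
    u x + a / 2 * ‖x‖ ^ 2 + ⟪z - x, q⟫ + a / 2 * ‖z - x‖ ^ 2 ≤ u z + a / 2 * ‖z‖ ^ 2 := by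
  have h1 := h z hz
  have h2 : ‖z‖ ^ 2 = ‖x‖ ^ 2 + 2 * ⟪z - x, x⟫ + ‖z - x‖ ^ 2 := by
    rw [real_inner_comm, ← norm_add_sq_real, add_sub_cancel]
  rw [inner_sub_right, inner_smul_right] at h1
  rw [h2]
  linarith

/-- The subgradient image of `V` for the function `u + (a / 2) * ‖·‖ ^ 2`. -/
def shiftedSubgradImage (U : Set (En n)) (u : En n → ℝ) (a : ℝ) (V : Set (En n)) : Set (En n) :=
  {q | ∃ x ∈ V, q - a • x ∈ subgrad U u x}

lemma isOpen_shiftedSubgradImage (ho : IsOpen U) (hu : ConvexOn ℝ U u) {a : ℝ} (ha : 0 < a)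
    {V : Set (En n)} (hV : IsOpen V) (hVU : V ⊆ U) : IsOpen (shiftedSubgradImage U u a V) := by
  rw [Metric.isOpen_iff]
  rintro q₀ ⟨x₀, hx₀, hq₀⟩
  obtain ⟨r, hr, hrV⟩ := Metric.nhds_basis_closedBall.mem_iff.1 (hV.mem_nhds hx₀)
  refine ⟨a / 2 * r, by positivity, fun q hq ↦ ?_⟩
  rw [mem_ball_iff_norm] at hq
  let g : En n → ℝ := fun z ↦ u z + a / 2 * ‖z‖ ^ 2 - ⟪z, q⟫
  have hg : ContinuousOn g (Metric.closedBall x₀ r) := by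
    have := (hu.continuousOn ho).mono (hrV.trans hVU)
    fun_prop
  obtain ⟨z, hz, hmin⟩ := (isCompact_closedBall x₀ r).exists_isMinOn
    ⟨x₀, Metric.mem_closedBall_self hr.le⟩ hg
  have hzr : z ∈ Metric.ball x₀ r := by
    by_contra hnot
    have hzx : ‖z - x₀‖ = r := le_antisymm (mem_closedBall_iff_norm.1 hz)
      (not_lt.1 fun h ↦ hnot (mem_ball_iff_norm.2 h))
    have h1 : g z ≤ g x₀ := hmin (Metric.mem_closedBall_self hr.le)
    have h2 := add_sq_le_of_sub_smul_mem_subgrad hq₀ (hVU (hrV hz))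
    have h3 := real_inner_le_norm (z - x₀) (q - q₀)
    have h4 : r * ‖q - q₀‖ < r * (a / 2 * r) := by gcongr
    simp only [g] at h1
    rw [inner_sub_left] at h2
    rw [inner_sub_right, inner_sub_left, inner_sub_left, hzx] at h3
    rw [hzx] at h2
    nlinarith
  refine ⟨z, hrV hz, sub_smul_mem_subgrad hu (hVU (hrV hz)) ?_⟩
  filter_upwards [Metric.isOpen_ball.mem_nhds hzr] with w hw _
  have h1 : g z ≤ g w := hmin (Metric.ball_subset_closedBall hw)
  simp only [g] at h1
  rw [inner_sub_left]
  linarith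

lemma volume_iUnion_subgrad_lt_top (ho : IsOpen U) (hu : ConvexOn ℝ U u) {K : Set (En n)}
    (hK : IsCompact K) (hKU : K ⊆ U) : volume (⋃ x ∈ K, subgrad U u x) < ∞ := by
  obtain ⟨r, hr, hrU⟩ := hK.exists_cthickening_subset_open ho hKU
  obtain ⟨M, hM⟩ := (hK.cthickening (r := r)).exists_bound_of_continuousOn
    ((hu.continuousOn ho).mono hrU)
  refine (measure_mono ?_).trans_lt (measure_closedBall_lt_top (x := 0) (r := 2 * M / r))
  simp only [iUnion_subset_iff]
  intro x hx y hy
  rw [mem_closedBall_zero_iff]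
  rcases eq_or_ne y 0 with rfl | hy0
  · have := (norm_nonneg _).trans (hM x (Metric.self_subset_cthickening K hx))
    rw [norm_zero]
    positivity
  have hny : 0 < ‖y‖ := norm_pos_iff.2 hy0
  set z : En n := x + (r / ‖y‖) • y with hz
  have hzK : z ∈ Metric.cthickening r K := by
    refine Metric.mem_cthickening_of_dist_le z x r K hx ?_
    rw [dist_eq_norm, hz, add_sub_cancel_left, norm_smul, Real.norm_of_nonneg (by positivity),
      div_mul_cancel₀ _ hny.ne']
  have h1 := hy z (hrU hzK)
  have h2 := abs_le.1 (hM z hzK)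
  have h3 := abs_le.1 (hM x (Metric.self_subset_cthickening K hx))
  rw [hz, add_sub_cancel_left, inner_smul_left, RCLike.conj_to_real, real_inner_self_eq_norm_sq,
    ← hz, show r / ‖y‖ * ‖y‖ ^ 2 = r * ‖y‖ by field_simp] at h1
  rw [le_div_iff₀ hr]
  linarith [h2.2, h3.1]

lemma MAmeasure_lt_volume_shiftedSubgradImage (hn : 0 < n) (ho : IsOpen U) (hu : ConvexOn ℝ U u)
    {a : ℝ} (ha : 0 < a) {V K : Set (En n)} (hV : IsOpen V) (hne : V.Nonempty) (hVK : V ⊆ K)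
    (hK : IsCompact K) (hKU : K ⊆ U) :
    MAmeasure U u V < volume (shiftedSubgradImage U u a V) := by
  have : Nontrivial (En n) :=
    Module.nontrivial_of_finrank_pos (R := ℝ) (by rwa [finrank_euclideanSpace_fin])
  have hVU := hVK.trans hKU
  set E := shiftedSubgradImage U u a V with hE
  have hfinV : MAmeasure U u V < ∞ :=
    (measure_mono (biUnion_subset_biUnion_left hVK)).trans_lt
      (volume_iUnion_subgrad_lt_top ho hu hK hKU)
  by_cases hfin : volume E = ∞
  · rwa [hfin]
  choose! X hXV hX using fun q (hq : q ∈ E) ↦ hq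
  have hmono : ∀ p x, x ∈ U → p - a • x ∈ subgrad U u x → ∀ q ∈ E,
      a * ‖x - X q‖ ^ 2 ≤ ⟪p - q, x - X q⟫ := by
    intro p x hx hp q hq
    have h := subgrad_monotone hx (hVU (hXV q hq)) hp (hX q hq)
    rw [show p - a • x - (q - a • X q) = (p - q) - a • (x - X q) by module, inner_sub_left,
      inner_smul_left, RCLike.conj_to_real, real_inner_self_eq_norm_sq] at h
    linarith
  have hXeq : ∀ q x, x ∈ V → q - a • x ∈ subgrad U u x → X q = x := by
    intro q x hx hq
    have h := hmono q x (hVU hx) hq q ⟨x, hx, hq⟩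
    rw [sub_self, inner_zero_left] at h
    have h0 : ‖x - X q‖ ^ 2 = 0 := le_antisymm (nonpos_of_mul_nonpos_right h ha) (sq_nonneg _)
    exact (sub_eq_zero.1 (norm_eq_zero.1 (pow_eq_zero_iff two_ne_zero |>.1 h0))).symm
  have hfirm : ∀ p ∈ E, ∀ q ∈ E, ‖a • X p - a • X q‖ ^ 2 ≤ ⟪p - q, a • X p - a • X q⟫ := by
    intro p hp q hq
    have h := hmono p (X p) (hVU (hXV p hp)) (hX p hp) q hq
    rw [← smul_sub, norm_smul, inner_smul_right, mul_pow, Real.norm_eq_abs, sq_abs]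
    nlinarith
  have himage : (fun q ↦ q - a • X q) '' E = ⋃ x ∈ V, subgrad U u x := by
    ext p
    simp only [mem_image, mem_iUnion, exists_prop]
    constructor
    · rintro ⟨q, hq, rfl⟩
      exact ⟨X q, hXV q hq, hX q hq⟩
    · rintro ⟨x, hx, hp⟩
      have hp' : p + a • x - a • x ∈ subgrad U u x := by rwa [add_sub_cancel_right]
      refine ⟨p + a • x, ⟨x, hx, hp'⟩, ?_⟩
      rw [hXeq _ x hx hp', add_sub_cancel_right]
  have hpos : volume ((fun q ↦ a • X q) '' E) ≠ 0 := by
    have hsub : (fun x ↦ a • x) '' V ⊆ (fun q ↦ a • X q) '' E := by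
      rintro _ ⟨x, hx, rfl⟩
      obtain ⟨p, hp⟩ := exists_mem_subgrad ho hu (hVU hx)
      have hp' : p + a • x - a • x ∈ subgrad U u x := by rwa [add_sub_cancel_right]
      exact ⟨p + a • x, ⟨x, hx, hp'⟩, by simp only [hXeq _ x hx hp']⟩
    exact fun h ↦ ((isOpenMap_smul₀ ha.ne' V hV).measure_pos volume (hne.image _)).ne'
      (measure_mono_null hsub h)
  have h := addHaar_image_id_sub_lt (μ := volume) (isOpen_shiftedSubgradImage ho hu ha hV hVU)
    hfirm hpos hfin
  rwa [himage] at h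

end Subgradient

theorem stmt13 {n : ℕ} (hn : 0 < n) (U : Set (En n))
    (hb : Bornology.IsBounded U) (hc : Convex ℝ U) (ho : IsOpen U)
    (up um : En n → ℝ) (hup : ConvexOn ℝ U up) (hum : ConvexOn ℝ U um)
    (hMA : ∀ s : Set (En n), MeasurableSet s → s ⊆ U →
      MAmeasure U up s ≤ MAmeasure U um s) :
    (⨅ x : U, ((up x - um x : ℝ) : EReal)) =
      ⨆ K : {K : Set (En n) // IsCompact K ∧ K ⊆ U},
        ⨅ x : ↥(U \ K.1), ((up x - um x : ℝ) : EReal) := by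
  refine le_antisymm ?_ ?_
  · refine le_iSup_of_le ⟨∅, isCompact_empty, empty_subset _⟩ ?_
    exact le_iInf fun x ↦ iInf_le (fun x : U ↦ ((up x - um x : ℝ) : EReal)) ⟨x, x.2.1⟩
  refine iSup_le fun ⟨K, hK, hKU⟩ ↦ le_iInf fun x₀ ↦ ?_
  by_contra! hlt
  obtain ⟨c, hc₀, hcK⟩ := EReal.lt_iff_exists_real_btwn.1 hlt
  have hc₀ : up x₀ - um x₀ < c := EReal.coe_lt_coe_iff.1 hc₀
  have hcK : ∀ z ∈ U, z ∉ K → c ≤ up z - um z := fun z hz hzK ↦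
    EReal.coe_le_coe_iff.1 (hcK.le.trans
      (iInf_le (fun x : ↥(U \ K) ↦ ((up x - um x : ℝ) : EReal)) ⟨z, hz, hzK⟩))
  obtain ⟨R, hR, hUR⟩ := hb.exists_pos_norm_le
  obtain ⟨a, ha, haR⟩ : ∃ a : ℝ, 0 < a ∧ a / 2 * R ^ 2 < c - (up x₀ - um x₀) := by
    refine ⟨(c - (up x₀ - um x₀)) / R ^ 2, div_pos (by linarith) (by positivity), ?_⟩
    rw [show (c - (up x₀ - um x₀)) / R ^ 2 / 2 * R ^ 2 = (c - (up x₀ - um x₀)) / 2 by field_simp]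
    linarith
  set t : ℝ := c - a / 2 * R ^ 2 with ht
  have hcup := hup.continuousOn ho
  have hcum := hum.continuousOn ho
  set g : En n → ℝ := fun z ↦ um z + a / 2 * ‖z‖ ^ 2 + t - up z with hg
  have hgc : ContinuousOn g U := by fun_prop
  set V : Set (En n) := U ∩ g ⁻¹' Ioi 0 with hVdef
  have hV : IsOpen V := hgc.isOpen_inter_preimage ho isOpen_Ioi
  have hVK : V ⊆ K := by
    rintro z ⟨hz, hgz⟩
    by_contra hzK
    have h1 := hcK z hz hzK
    have h2 : a / 2 * ‖z‖ ^ 2 ≤ a / 2 * R ^ 2 := by gcongr; exact hUR z hz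
    simp only [hg, mem_preimage, mem_Ioi] at hgz
    linarith
  have hx₀V : (x₀ : En n) ∈ V := by
    refine ⟨x₀.2, ?_⟩
    have : 0 ≤ a / 2 * ‖(x₀ : En n)‖ ^ 2 := by positivity
    simp only [hg, mem_preimage, mem_Ioi]
    linarith
  have hsub : shiftedSubgradImage U um a V ⊆ ⋃ x ∈ V, subgrad U up x := by
    rintro q ⟨x, hxV, hq⟩
    have hcont : ContinuousOn (fun z ↦ up z - ⟪z, q⟫) K := by
      have := hcup.mono hKU
      fun_prop
    obtain ⟨z, hz, hmin⟩ := hK.exists_isMinOn ⟨x, hVK hxV⟩ hcont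
    have hsup : ∀ w ∈ U, um x + a / 2 * ‖x‖ ^ 2 + (⟪w, q⟫ - ⟪x, q⟫) ≤ um w + a / 2 * ‖w‖ ^ 2 := by
      intro w hw
      have h := add_sq_le_of_sub_smul_mem_subgrad hq hw
      rw [inner_sub_left] at h
      have : 0 ≤ a / 2 * ‖w - x‖ ^ 2 := by positivity
      linarith
    have hzx : up z - ⟪z, q⟫ ≤ up x - ⟪x, q⟫ := hmin (hVK hxV)
    have hgx : 0 < um x + a / 2 * ‖x‖ ^ 2 + t - up x := hxV.2
    have hzV : z ∈ V := by
      refine ⟨hKU hz, ?_⟩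
      have := hsup z (hKU hz)
      simp only [hg, mem_preimage, mem_Ioi]
      linarith
    refine mem_biUnion hzV fun w hw ↦ ?_
    rw [inner_sub_left]
    by_cases hwV : w ∈ V
    · have : up z - ⟪z, q⟫ ≤ up w - ⟪w, q⟫ := hmin (hVK hwV)
      linarith
    · have h1 : um w + a / 2 * ‖w‖ ^ 2 + t - up w ≤ 0 := not_lt.1 fun h ↦ hwV ⟨hw, h⟩
      have := hsup w hw
      linarith
  have h1 := MAmeasure_lt_volume_shiftedSubgradImage hn ho hum ha hV ⟨_, hx₀V⟩ hVK hK hKU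
  exact absurd (hMA V hV.measurableSet inter_subset_left)
    (h1.trans_le (measure_mono hsub)).not_ge
end
end

section
/- Let Ω ⊆ ℝ² be a bounded convex open set and L ⊆ ℝ² a line such that L ∩ ∂Ω is a nondegenerate segment, and let x₀ be an interior point of that segment. Then there is a constant c > 0 and a neighborhood V of x₀ such that the Cheng–Yau support function satisfies w_Ω(x) ≤ −c·dist(x, L)^{1/3} for all x ∈ Ω ∩ V. -/
open Set Filter Topology Metric
open scoped RealInnerProductSpace

noncomputable section

/-- The determinant of the Hessian matrix of `w` at `x`. -/
def hessDet {n : ℕ} (w : En n → ℝ) (x : En n) : ℝ :=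
  Matrix.det (Matrix.of fun i j : Fin n =>
    fderiv ℝ (fderiv ℝ w) x (EuclideanSpace.single i 1) (EuclideanSpace.single j 1))

/-- `w` is the Cheng–Yau support function of the bounded convex domain `Ω ⊆ ℝ²`:
the negative convex solution, continuous up to the boundary and smooth inside, of
`det D²w = (−w)^{−4}` in `Ω` with `w = 0` on `∂Ω`. -/
def IsChengYau2 (Ω : Set (En 2)) (w : En 2 → ℝ) : Prop :=
  ContinuousOn w (closure Ω) ∧ ContDiffOn ℝ (⊤ : ℕ∞) w Ω ∧
    ConvexOn ℝ (closure Ω) w ∧ (∀ x ∈ Ω, w x < 0) ∧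
    (∀ x ∈ frontier Ω, w x = 0) ∧
    (∀ x ∈ Ω, hessDet w x = (-(w x)) ^ (-4 : ℤ))

theorem second_deriv_nonpos_of_isLocalMax {f f' : ℝ → ℝ} {a f'' : ℝ}
    (hf : ∀ᶠ h in 𝓝 a, HasDerivAt f (f' h) h) (hf' : HasDerivAt f' f'' a)
    (hmax : IsLocalMax f a) : f'' ≤ 0 := by
  by_contra! hpos
  have hderiv : deriv f =ᶠ[𝓝 a] f' := hf.mono fun h hh => hh.deriv
  have hdd : deriv (deriv f) a = f'' := hderiv.deriv_eq.trans hf'.deriv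
  have hmin : IsLocalMin f a :=
    isLocalMin_of_deriv_deriv_pos (by rwa [hdd]) hmax.deriv_eq_zero
      hf.self_of_nhds.continuousAt
  have hconst : f =ᶠ[𝓝 a] fun _ => f a := by
    filter_upwards [hmax, hmin] with x h1 h2 using le_antisymm h1 h2
  have h0 : deriv f =ᶠ[𝓝 a] fun _ => 0 := by
    simpa using hconst.deriv
  have := h0.deriv_eq
  rw [hdd] at this
  simp at this
  linarith

/-- Along a line through a point of smoothness, the second derivative is given by the Hessian. -/
theorem ContDiffAt.hasDerivAt_along_line {E : Type*} [NormedAddCommGroup E] [NormedSpace ℝ E]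
    {w : E → ℝ} {x : E} (hw : ContDiffAt ℝ 2 w x) (e : E) :
    (∀ᶠ h : ℝ in 𝓝 0,
      HasDerivAt (fun h : ℝ => w (x + h • e)) (fderiv ℝ w (x + h • e) e) h) ∧
    HasDerivAt (fun h : ℝ => fderiv ℝ w (x + h • e) e) (fderiv ℝ (fderiv ℝ w) x e e) 0 := by
  have hline : ∀ h : ℝ, HasDerivAt (fun h : ℝ => x + h • e) e h := fun h => by
    simpa using ((hasDerivAt_id h).smul_const e).const_add x
  constructor
  · have hev : ∀ᶠ y in 𝓝 x, ContDiffAt ℝ 2 w y := hw.eventually (by simp)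
    have ht : Tendsto (fun h : ℝ => x + h • e) (𝓝 0) (𝓝 x) := by
      simpa using (hline 0).continuousAt.tendsto
    filter_upwards [ht.eventually hev] with h hh
    exact (hh.differentiableAt (by simp)).hasFDerivAt.comp_hasDerivAt h (hline h)
  · have h1 : DifferentiableAt ℝ (fderiv ℝ w) x :=
      (hw.fderiv_right (m := 1) (by norm_num)).differentiableAt (by simp)
    have h2 : HasFDerivAt (fderiv ℝ w) (fderiv ℝ (fderiv ℝ w) x) (x + (0 : ℝ) • e) := by
      simpa using h1.hasFDerivAt
    have h3 := h2.comp_hasDerivAt 0 (hline 0)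
    simpa using h3.clm_apply (hasDerivAt_const 0 e)

theorem ConvexOn.fderiv_fderiv_apply_nonneg {E : Type*} [NormedAddCommGroup E] [NormedSpace ℝ E]
    {w : E → ℝ} {s : Set E} {x : E} (hconv : ConvexOn ℝ s w) (hs : s ∈ 𝓝 x)
    (hw : ContDiffAt ℝ 2 w x) (e : E) : 0 ≤ fderiv ℝ (fderiv ℝ w) x e e := by
  obtain ⟨h1, h2⟩ := hw.hasDerivAt_along_line e
  have ht : Tendsto (fun h : ℝ => x + h • e) (𝓝 0) (𝓝 x) := by
    have : Continuous fun h : ℝ => x + h • e := by fun_prop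
    simpa using this.tendsto 0
  obtain ⟨ε, hε, hball⟩ := Metric.eventually_nhds_iff_ball.1 (h1.and (ht.eventually hs))
  have hcomp : ConvexOn ℝ (ball (0 : ℝ) ε) fun h : ℝ => w (x + h • e) := by
    refine ⟨convex_ball _ _, fun p hp q hq α β hα hβ hαβ => ?_⟩
    have := hconv.2 (hball p hp).2 (hball q hq).2 hα hβ hαβ
    have hx : α • (x + p • e) + β • (x + q • e) = x + (α • p + β • q) • e := by
      have hx' : x = (α + β) • x := by rw [hαβ, one_smul]
      nth_rewrite 3 [hx']
      simp only [smul_eq_mul]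
      module
    rwa [hx] at this
  have hmono := hcomp.monotoneOn_deriv fun h hh => (hball h hh).1.differentiableAt
  have hderiv : deriv (fun h : ℝ => w (x + h • e)) =ᶠ[𝓝 0]
      fun h : ℝ => fderiv ℝ w (x + h • e) e := h1.mono fun h hh => hh.deriv
  have hmem : ball (0 : ℝ) ε ∈ 𝓝 0 := ball_mem_nhds _ hε
  have hnn := hmono.derivWithin_nonneg (x := 0)
  rwa [derivWithin_of_mem_nhds hmem, hderiv.deriv_eq, h2.deriv] at hnn

/-- The Hessian determinant in the (not necessarily orthonormal) basis `e, v`. -/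
theorem sq_mul_hessDet (w : En 2 → ℝ) (x e v : En 2) :
    (e 0 * v 1 - e 1 * v 0) ^ 2 * hessDet w x =
      fderiv ℝ (fderiv ℝ w) x e e * fderiv ℝ (fderiv ℝ w) x v v -
        fderiv ℝ (fderiv ℝ w) x e v * fderiv ℝ (fderiv ℝ w) x v e := by
  have hexp : ∀ y : En 2, y = y 0 • EuclideanSpace.single 0 1 + y 1 • EuclideanSpace.single 1 1 := by
    intro y
    ext i
    fin_cases i <;> simp
  rw [hessDet, Matrix.det_fin_two]
  conv_rhs => rw [hexp e, hexp v]
  simp only [map_add, map_smul, add_apply, smul_apply,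
    smul_eq_mul, Matrix.of_apply]
  ring

/-- A line containing a nondegenerate segment of the boundary misses the open convex set. -/
theorem Convex.line_notMem_of_segment_subset_frontier {E : Type*} [NormedAddCommGroup E]
    [NormedSpace ℝ E] {Ω : Set E} (hc : Convex ℝ Ω) (ho : IsOpen Ω) {a b : E}
    (hseg : segment ℝ a b ⊆ frontier Ω) (l : ℝ) : a + l • (b - a) ∉ Ω := by
  intro hy
  have hdisj : ∀ z ∈ segment ℝ a b, z ∉ Ω := fun z hz hzΩ => by
    have := (hseg hz).2
    rw [ho.interior_eq] at this
    exact this hzΩ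
  have ha := hseg (left_mem_segment ℝ a b)
  have hb := hseg (right_mem_segment ℝ a b)
  rcases lt_or_ge l 0 with hl | hl
  · refine hdisj a (left_mem_segment ℝ a b) (interior_subset
      (hc.openSegment_interior_closure_subset_interior (ho.interior_eq.symm ▸ hy) hb.1
        (x := a + l • (b - a)) ⟨1 / (1 - l), -l / (1 - l), ?_, ?_, ?_, ?_⟩))
    · have : 0 < 1 - l := by linarith
      positivity
    · exact div_pos (by linarith) (by linarith)
    · have : 1 - l ≠ 0 := by linarith
      field_simp
      ring
    · have : 1 - l ≠ 0 := by linarith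
      match_scalars <;> field_simp <;> ring
  rcases le_or_gt l 1 with hl1 | hl1
  · refine hdisj _ ?_ hy
    rw [segment_eq_image']
    exact ⟨l, ⟨hl, hl1⟩, rfl⟩
  · refine hdisj b (right_mem_segment ℝ a b) (interior_subset
      (hc.openSegment_interior_closure_subset_interior (ho.interior_eq.symm ▸ hy) ha.1
        (x := a + l • (b - a)) ⟨1 / l, 1 - 1 / l, ?_, ?_, ?_, ?_⟩))
    · positivity
    · rw [sub_pos, div_lt_one (by linarith)]; exact hl1
    · ring
    · have : l ≠ 0 := by linarith
      match_scalars <;> field_simp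
      ring

/-- The Hessian bounds of the barrier `-c u (1/4 - σ²)`, `u = t^{1/3}`, are incompatible with the
Monge-Ampère equation where a solution `-m` lies above the barrier. -/
theorem no_interior_max {c u σ D m A B : ℝ} (hc0 : 0 < c) (hc1 : c ≤ 1) (hcD : c ≤ |D|)
    (hu0 : 0 < u) (hσ : σ ^ 2 < 1 / 4) (hm0 : 0 < m) (hmlt : m < c * u * (1 / 4 - σ ^ 2))
    (hA0 : 0 ≤ A) (hA : A ≤ 2 * c * u) (hB : B ≤ c * (1 / 4 - σ ^ 2) * (2 / 9) * (u ^ 5)⁻¹)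
    (hAB : D ^ 2 * m ^ (-4 : ℤ) ≤ A * B) : False := by
  have hσ2 : 0 < 1 / 4 - σ ^ 2 := by linarith
  have hcu : 0 < c * u := mul_pos hc0 hu0
  have hmul : A * B ≤ 2 * c * u * (c * (1 / 4 - σ ^ 2) * (2 / 9) * (u ^ 5)⁻¹) :=
    (mul_le_mul_of_nonneg_left hB hA0).trans (mul_le_mul_of_nonneg_right hA (by positivity))
  have hbound : 2 * c * u * (c * (1 / 4 - σ ^ 2) * (2 / 9) * (u ^ 5)⁻¹) ≤ c ^ 2 * (u ^ 4)⁻¹ := by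
    have : 2 * c * u * (c * (1 / 4 - σ ^ 2) * (2 / 9) * (u ^ 5)⁻¹) =
        c ^ 2 * (u ^ 4)⁻¹ * ((4 / 9) * (1 / 4 - σ ^ 2)) := by
      generalize 1 / 4 - σ ^ 2 = k
      field_simp
      ring
    rw [this]
    exact mul_le_of_le_one_right (by positivity) (by linarith [sq_nonneg σ])
  have hineq := hAB.trans (hmul.trans hbound)
  have hzpow : m ^ (-4 : ℤ) = (m ^ 4)⁻¹ := by
    rw [zpow_neg]; norm_cast
  rw [hzpow, ← div_eq_mul_inv, ← div_eq_mul_inv, div_le_div_iff₀ (by positivity) (by positivity)]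
    at hineq
  have hmcu : m < c * u :=
    hmlt.trans_le (mul_le_of_le_one_right hcu.le (by linarith [sq_nonneg σ]))
  have hm4 : m ^ 4 < (c * u) ^ 4 := pow_lt_pow_left₀ hmcu hm0.le (by norm_num)
  have hcD2 : c ^ 2 ≤ D ^ 2 := sq_le_sq.2 (by rwa [abs_of_pos hc0])
  have hc4 : c ^ 4 ≤ 1 := pow_le_one₀ hc0.le hc1
  have h1 : D ^ 2 * u ^ 4 < c ^ 2 * (c * u) ^ 4 :=
    hineq.trans_lt (mul_lt_mul_of_pos_left hm4 (by positivity))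
  have h2 : c ^ 2 * (c * u) ^ 4 ≤ c ^ 2 * u ^ 4 := by
    rw [mul_pow]
    exact mul_le_mul_of_nonneg_left (mul_le_of_le_one_left (by positivity) hc4) (by positivity)
  have h3 : c ^ 2 * u ^ 4 ≤ D ^ 2 * u ^ 4 := mul_le_mul_of_nonneg_right hcD2 (by positivity)
  linarith

/-- The barrier `-c t^{1/3} (1/4 - s²)` dominates a solution on the parallelogram
`{x₀ + s e + t v : |s| ≤ 1/2, 0 ≤ t ≤ 1/2}`, provided it does so on the side `t = 1/2`. -/
theorem IsChengYau2.le_barrier {Ω : Set (En 2)} (ho : IsOpen Ω) {w : En 2 → ℝ}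
    (hw : IsChengYau2 Ω w) {x₀ e v : En 2}
    (hΩ : ∀ s t : ℝ, |s| ≤ 1 / 2 → 0 < t → t ≤ 1 / 2 → x₀ + s • e + t • v ∈ Ω)
    (hcl : ∀ s : ℝ, |s| ≤ 1 / 2 → x₀ + s • e ∈ frontier Ω)
    {c : ℝ} (hc0 : 0 < c) (hc1 : c ≤ 1) (hcD : c ≤ |e 0 * v 1 - e 1 * v 0|)
    (htop : ∀ s : ℝ, |s| ≤ 1 / 2 → w (x₀ + s • e + (1 / 2 : ℝ) • v) ≤ -c)
    {s t : ℝ} (hs : |s| ≤ 1 / 2) (ht0 : 0 ≤ t) (ht1 : t ≤ 1 / 2) :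
    w (x₀ + s • e + t • v) ≤ -(c * t ^ ((1 : ℝ) / 3) * (1 / 4 - s ^ 2)) := by
  obtain ⟨hcont, hsm, hconv, hneg, hbd, hdet⟩ := hw
  let K : Set (ℝ × ℝ) := Icc (-(1 / 2)) (1 / 2) ×ˢ Icc 0 (1 / 2)
  set g : ℝ × ℝ → ℝ := fun z => w (x₀ + z.1 • e + z.2 • v) +
    c * z.2 ^ ((1 : ℝ) / 3) * (1 / 4 - z.1 ^ 2) with hg
  have hmapsTo : ∀ z ∈ K, x₀ + z.1 • e + z.2 • v ∈ closure Ω := by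
    rintro ⟨s, t⟩ ⟨hs, ht⟩
    rcases ht.1.eq_or_lt with h | h
    · simp only at h
      subst h
      simpa using (hcl s (abs_le.2 hs)).1
    · exact subset_closure (hΩ s t (abs_le.2 hs) h ht.2)
  have hgc : ContinuousOn g K := by
    refine (hcont.comp (by fun_prop) hmapsTo).add (Continuous.continuousOn ?_)
    have : Continuous fun z : ℝ × ℝ => z.2 ^ ((1 : ℝ) / 3) :=
      (Real.continuous_rpow_const (by norm_num)).comp continuous_snd
    fun_prop
  have hKc : IsCompact K := isCompact_Icc.prod isCompact_Icc
  have hst : (s, t) ∈ K := ⟨abs_le.1 hs, ht0, ht1⟩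
  obtain ⟨⟨σ, τ⟩, hz, hmax⟩ := hKc.exists_isMaxOn ⟨_, hst⟩ hgc
  suffices hle : g (σ, τ) ≤ 0 by
    have hst' : g (s, t) ≤ 0 := (hmax hst).trans hle
    simp only [hg] at hst'
    linarith
  clear hst hs ht0 ht1
  by_contra! hpos
  obtain ⟨hσ, hτ⟩ := hz
  simp only at hσ hτ
  have hwle : ∀ y ∈ closure Ω, w y ≤ 0 := fun y hy => by
    by_cases h : y ∈ Ω
    · exact (hneg y h).le
    · exact (hbd y ⟨hy, by rwa [ho.interior_eq]⟩).le
  have hwz := hwle _ (hmapsTo (σ, τ) ⟨hσ, hτ⟩)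
  simp only [hg] at hpos hwz
  have hσ2 : 0 ≤ 1 / 4 - σ ^ 2 := by nlinarith [hσ.1, hσ.2]
  have hprod : 0 < c * τ ^ ((1 : ℝ) / 3) * (1 / 4 - σ ^ 2) := by linarith
  have hτ0 : 0 < τ := by
    refine hτ.1.lt_of_ne fun h => ?_
    rw [← h, Real.zero_rpow (by norm_num)] at hprod
    simp at hprod
  have hσ2' : 0 < 1 / 4 - σ ^ 2 := by
    refine hσ2.lt_of_ne fun h => ?_
    rw [← h] at hprod
    simp at hprod
  have hτ1 : τ < 1 / 2 := by
    refine hτ.2.lt_of_ne fun h => ?_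
    subst h
    have h1 := htop σ (abs_le.2 hσ)
    have h2 : (1 / 2 : ℝ) ^ ((1 : ℝ) / 3) ≤ 1 :=
      Real.rpow_le_one (by norm_num) (by norm_num) (by norm_num)
    have h3 : c * (1 / 2 : ℝ) ^ ((1 : ℝ) / 3) ≤ c := by nlinarith
    nlinarith [sq_nonneg σ]
  have hσa : -(1 / 2) < σ := by nlinarith [hσ.1, hσ.2]
  have hσb : σ < 1 / 2 := by nlinarith [hσ.1, hσ.2]
  set x : En 2 := x₀ + σ • e + τ • v with hx
  have hxΩ : x ∈ Ω := hΩ σ τ (abs_le.2 hσ) hτ0 hτ.2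
  have hwx : ContDiffAt ℝ 2 w x :=
    ((hsm x hxΩ).contDiffAt (ho.mem_nhds hxΩ)).of_le (WithTop.coe_le_coe.2 (le_top : (2 : ℕ∞) ≤ ⊤))
  obtain ⟨he1, he2⟩ := hwx.hasDerivAt_along_line e
  obtain ⟨hv1, hv2⟩ := hwx.hasDerivAt_along_line v
  have hclx : closure Ω ∈ 𝓝 x := mem_of_superset (ho.mem_nhds hxΩ) subset_closure
  have hBe := hconv.fderiv_fderiv_apply_nonneg hclx hwx e
  have hsymm : fderiv ℝ (fderiv ℝ w) x e v = fderiv ℝ (fderiv ℝ w) x v e :=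
    (hwx.isSymmSndFDerivAt (by simp)) e v
  have hdet' := sq_mul_hessDet w x e v
  rw [hdet x hxΩ, hsymm] at hdet'
  have hloc : IsLocalMax g (σ, τ) := hmax.isLocalMax
    (prod_mem_nhds (Icc_mem_nhds hσa hσb) (Icc_mem_nhds hτ0 hτ1))
  set u : ℝ := τ ^ ((1 : ℝ) / 3) with hu
  have hu0 : 0 < u := Real.rpow_pos_of_pos hτ0 _
  have hee : fderiv ℝ (fderiv ℝ w) x e e ≤ 2 * c * u := by
    have hm : IsLocalMax (fun h : ℝ => w (x + h • e) + c * u * (1 / 4 - (σ + h) ^ 2)) 0 := by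
      have ht : Tendsto (fun h : ℝ => ((σ + h, τ) : ℝ × ℝ)) (𝓝 0) (𝓝 (σ, τ)) := by
        have : Continuous fun h : ℝ => ((σ + h, τ) : ℝ × ℝ) := by fun_prop
        simpa using this.tendsto 0
      filter_upwards [ht.eventually hloc] with h hh
      simp only [hg] at hh
      have hxe : x₀ + (σ + h) • e + τ • v = x + h • e := by rw [hx]; module
      rw [hxe] at hh
      simpa [hu] using hh
    have := second_deriv_nonpos_of_isLocalMax
      (f' := fun h => fderiv ℝ w (x + h • e) e + c * u * (-(2 * (σ + h))))
      (f'' := fderiv ℝ (fderiv ℝ w) x e e + c * u * (-2)) ?_ ?_ hm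
    · linarith
    · filter_upwards [he1] with h hh
      refine hh.add (HasDerivAt.const_mul _ ?_)
      have := (((hasDerivAt_id h).const_add σ).pow 2).const_sub (1 / 4)
      simpa only [id, Pi.pow_apply, Nat.cast_ofNat, Nat.add_one_sub_one, pow_one, mul_one] using this
    · refine he2.add (HasDerivAt.const_mul _ ?_)
      have := ((hasDerivAt_id (0 : ℝ)).const_add σ).const_mul (-2)
      simpa only [id, mul_one, neg_mul] using this
  have hvv : fderiv ℝ (fderiv ℝ w) x v v ≤ c * (1 / 4 - σ ^ 2) * (2 / 9) * (u ^ 5)⁻¹ := by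
    have hm : IsLocalMax
        (fun h : ℝ => w (x + h • v) + c * (1 / 4 - σ ^ 2) * (τ + h) ^ ((1 : ℝ) / 3)) 0 := by
      have ht : Tendsto (fun h : ℝ => ((σ, τ + h) : ℝ × ℝ)) (𝓝 0) (𝓝 (σ, τ)) := by
        have : Continuous fun h : ℝ => ((σ, τ + h) : ℝ × ℝ) := by fun_prop
        simpa using this.tendsto 0
      filter_upwards [ht.eventually hloc] with h hh
      simp only [hg] at hh
      have hxe : x₀ + σ • e + (τ + h) • v = x + h • v := by rw [hx]; module
      rw [hxe] at hh
      simp only [zero_smul, add_zero]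
      linarith
    have hpow : τ ^ ((1 : ℝ) / 3 - 1 - 1) = (u ^ 5)⁻¹ := by
      rw [hu, ← Real.rpow_natCast, ← Real.rpow_mul hτ0.le, ← Real.rpow_neg hτ0.le]
      norm_num
    have := second_deriv_nonpos_of_isLocalMax
      (f' := fun h => fderiv ℝ w (x + h • v) v +
        c * (1 / 4 - σ ^ 2) * (1 / 3 * (τ + h) ^ ((1 : ℝ) / 3 - 1)))
      (f'' := fderiv ℝ (fderiv ℝ w) x v v +
        c * (1 / 4 - σ ^ 2) * (1 / 3 * ((1 / 3 - 1) * τ ^ ((1 : ℝ) / 3 - 1 - 1)))) ?_ ?_ hm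
    · rw [hpow] at this
      linarith
    · have hp : ∀ᶠ h : ℝ in 𝓝 0, 0 < τ + h := by
        have : Continuous fun h : ℝ => τ + h := by fun_prop
        exact this.continuousAt.eventually (lt_mem_nhds (by simpa using hτ0))
      filter_upwards [hv1, hp] with h hh hp
      refine hh.add (HasDerivAt.const_mul _ ?_)
      simpa using ((hasDerivAt_id h).const_add τ).rpow_const (p := 1 / 3) (Or.inl hp.ne')
    · refine hv2.add (HasDerivAt.const_mul _ (HasDerivAt.const_mul _ ?_))
      simpa using ((hasDerivAt_id (0 : ℝ)).const_add τ).rpow_const (p := 1 / 3 - 1)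
        (Or.inl (by simpa using hτ0.ne'))
  set D : ℝ := e 0 * v 1 - e 1 * v 0 with hD
  set m : ℝ := -w x with hm
  have hm0 : 0 < m := by linarith [hneg x hxΩ]
  refine no_interior_max hc0 hc1 hcD hu0 (by linarith : σ ^ 2 < 1 / 4) hm0 (by linarith) hBe hee
    hvv ?_
  rw [hdet']
  linarith [mul_self_nonneg (fderiv ℝ (fderiv ℝ w) x v e)]

theorem stmt17 (Ω : Set (En 2))
    (hb : Bornology.IsBounded Ω) (hc : Convex ℝ Ω) (ho : IsOpen Ω)
    (L : Set (En 2)) (hL : ∃ p v : En 2, v ≠ 0 ∧ L = {q | ∃ t : ℝ, q = p + t • v})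
    (a b : En 2) (hab : a ≠ b) (hseg : segment ℝ a b = L ∩ frontier Ω)
    (x₀ : En 2) (hx₀ : x₀ ∈ openSegment ℝ a b)
    (w : En 2 → ℝ) (hw : IsChengYau2 Ω w) :
    ∃ c : ℝ, 0 < c ∧ ∃ V ∈ 𝓝 x₀, ∀ x ∈ Ω ∩ V,
      w x ≤ -c * (Metric.infDist x L) ^ ((1 : ℝ) / 3) := by
  obtain ⟨p, y, hy0, rfl⟩ := hL
  have hsegF : segment ℝ a b ⊆ frontier Ω := hseg ▸ inter_subset_right
  have hsegL : segment ℝ a b ⊆ {q | ∃ t : ℝ, q = p + t • y} := hseg ▸ inter_subset_left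
  have hmiss := hc.line_notMem_of_segment_subset_frontier ho hsegF
  obtain ⟨ta, hta⟩ := hsegL (left_mem_segment ℝ a b)
  obtain ⟨tb, htb⟩ := hsegL (right_mem_segment ℝ a b)
  obtain ⟨q, hq⟩ : Ω.Nonempty :=
    closure_nonempty_iff.1 ⟨a, (hsegF (left_mem_segment ℝ a b)).1⟩
  obtain ⟨α, β, hα, hβ, hαβ, hx₀'⟩ := hx₀
  obtain rfl : α = 1 - β := by linarith
  set μ : ℝ := min (1 - β) β
  have hμ0 : 0 < μ := lt_min hα hβ
  have hμ1 : μ ≤ 1 - β := min_le_left _ _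
  have hμ2 : μ ≤ β := min_le_right _ _
  set e : En 2 := μ • (b - a) with he
  set v : En 2 := q - x₀ with hv
  have hline : ∀ s : ℝ, x₀ + s • e = a + (β + s * μ) • (b - a) := fun s => by
    rw [he, ← hx₀']; module
  have hside : ∀ s : ℝ, |s| ≤ 1 → x₀ + s • e ∈ frontier Ω := fun s hs => by
    apply hsegF
    rw [hline, segment_eq_image']
    have := abs_le.1 hs
    exact ⟨_, ⟨by nlinarith, by nlinarith⟩, rfl⟩
  have hmiss' : ∀ s : ℝ, x₀ + s • e ∉ Ω := fun s => by
    rw [hline]; exact hmiss _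
  have he0 : e ≠ 0 := smul_ne_zero hμ0.ne' (sub_ne_zero.2 hab.symm)
  have hv0 : v ≠ 0 := fun h => hmiss' 0 (by
    rw [hv, sub_eq_zero] at h
    simpa [← h] using hq)
  set D : ℝ := e 0 * v 1 - e 1 * v 0 with hD
  have hD0 : D ≠ 0 := by
    intro h0
    have hqe : ∀ s : ℝ, v ≠ s • e := fun s hs => hmiss' s (by
      rw [← hs, hv]; simpa using hq)
    by_cases h : e 0 = 0
    · have h1 : e 1 ≠ 0 := fun h1 => he0 (by ext i; fin_cases i <;> simp [h, h1])
      apply hqe (v 1 / e 1)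
      ext i
      fin_cases i
      · have : e 1 * v 0 = 0 := by rw [hD, h] at h0; linarith
        simpa [h, h1] using this
      · simp [h1]
    · apply hqe (v 0 / e 0)
      ext i
      fin_cases i
      · simp [h]
      · simp
        field_simp
        linarith
  have hΩ : ∀ s t : ℝ, |s| ≤ 1 / 2 → 0 < t → t ≤ 1 / 2 → x₀ + s • e + t • v ∈ Ω := by
    intro s t hs ht0 ht1
    have ht : 0 < 1 - t := by linarith
    have hfr : x₀ + (s / (1 - t)) • e ∈ closure Ω := by
      refine (hside _ ?_).1
      rw [abs_div, abs_of_pos ht, div_le_one ht]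
      linarith
    have := hc.openSegment_closure_interior_subset_interior hfr
      (ho.interior_eq.symm ▸ hq : q ∈ interior Ω)
    refine interior_subset (this ⟨1 - t, t, ht, ht0, by ring, ?_⟩)
    rw [smul_add, smul_smul, mul_div_cancel₀ _ ht.ne', hv]
    module
  obtain ⟨δ, hδ0, hδ⟩ : ∃ δ > 0, ∀ s : ℝ, |s| ≤ 1 / 2 →
      w (x₀ + s • e + (1 / 2 : ℝ) • v) ≤ -δ := by
    have hcomp : ContinuousOn (fun s : ℝ => w (x₀ + s • e + (1 / 2 : ℝ) • v))
        (Icc (-(1 / 2)) (1 / 2)) := hw.1.comp (by fun_prop) fun s hs =>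
      subset_closure (hΩ s _ (abs_le.2 hs) (by norm_num) le_rfl)
    obtain ⟨s, hs, hmax⟩ := isCompact_Icc.exists_isMaxOn ⟨0, by norm_num⟩ hcomp
    refine ⟨-w (x₀ + s • e + (1 / 2 : ℝ) • v), ?_, fun r hr => ?_⟩
    · exact neg_pos.2 (hw.2.2.2.1 _ (hΩ s _ (abs_le.2 hs) (by norm_num) le_rfl))
    · rw [neg_neg]; exact hmax (abs_le.1 hr)
  let c : ℝ := min (min 1 |D|) δ
  have hc0 : 0 < c := lt_min (lt_min one_pos (abs_pos.2 hD0)) hδ0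
  have hbar := fun s t => hw.le_barrier ho hΩ (fun s hs => hside s (by linarith)) hc0
    ((min_le_left _ _).trans (min_le_left _ _)) ((min_le_left _ _).trans (min_le_right _ _))
    (fun s hs => (hδ s hs).trans (neg_le_neg (min_le_right _ _))) (s := s) (t := t)
  set S : En 2 → ℝ := fun x => ((x 0 - x₀ 0) * v 1 - (x 1 - x₀ 1) * v 0) / D with hS
  set T : En 2 → ℝ := fun x => (e 0 * (x 1 - x₀ 1) - e 1 * (x 0 - x₀ 0)) / D with hT
  have hcoord : ∀ x, x = x₀ + S x • e + T x • v := by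
    intro x
    ext i
    fin_cases i <;> simp [hS, hT] <;> field_simp <;> rw [hD] <;> ring
  have hSc : Continuous S := by fun_prop
  have hTc : Continuous T := by fun_prop
  have hTpos : ∀ x ∈ Ω, 0 < T x := by
    intro x hx
    by_contra! hneg
    have hT1 : 0 < 1 - T x := by linarith
    have := hc hx hq (a := 1 / (1 - T x)) (b := -T x / (1 - T x)) (by positivity)
      (div_nonneg (by linarith) hT1.le) (by field_simp; ring)
    apply hmiss' (S x / (1 - T x))
    convert this using 1
    have hqv : q = x₀ + v := by rw [hv]; abel
    nth_rewrite 4 [hcoord x]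
    rw [hqv]
    match_scalars <;> field_simp <;> ring
  have hvn : 0 < ‖v‖ := norm_pos_iff.2 hv0
  refine ⟨c * (3 / 16) / ‖v‖ ^ ((1 : ℝ) / 3), by positivity,
    {x | |S x| < 1 / 4 ∧ T x < 1 / 2}, ?_, ?_⟩
  · have h1 : ∀ᶠ x in 𝓝 x₀, |S x| < 1 / 4 :=
      hSc.abs.continuousAt.eventually (gt_mem_nhds (by simp [hS]))
    have h2 : ∀ᶠ x in 𝓝 x₀, T x < 1 / 2 :=
      hTc.continuousAt.eventually (gt_mem_nhds (by simp [hT]))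
    exact h1.and h2
  · rintro x ⟨hx, hxS, hxT⟩
    have hT0 := hTpos x hx
    have hwx := hbar (S x) (T x) (by linarith) hT0.le hxT.le
    rw [← hcoord x] at hwx
    have hdist : infDist x {q | ∃ t : ℝ, q = p + t • y} ≤ T x * ‖v‖ := by
      have hmem : x₀ + S x • e ∈ {q | ∃ t : ℝ, q = p + t • y} := by
        refine ⟨ta + (β + S x * μ) * (tb - ta), ?_⟩
        rw [hline, htb, hta]
        module
      refine (infDist_le_dist_of_mem hmem).trans_eq ?_
      have : x - (x₀ + S x • e) = T x • v := by
        nth_rewrite 1 [hcoord x]; abel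
      rw [dist_eq_norm, this, norm_smul, Real.norm_of_nonneg hT0.le]
    have hpow : infDist x {q | ∃ t : ℝ, q = p + t • y} ^ ((1 : ℝ) / 3) ≤
        T x ^ ((1 : ℝ) / 3) * ‖v‖ ^ ((1 : ℝ) / 3) := by
      rw [← Real.mul_rpow hT0.le hvn.le]
      exact Real.rpow_le_rpow infDist_nonneg hdist (by norm_num)
    have hv3 : 0 < ‖v‖ ^ ((1 : ℝ) / 3) := Real.rpow_pos_of_pos hvn _
    have hT3 : 0 < T x ^ ((1 : ℝ) / 3) := Real.rpow_pos_of_pos hT0 _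
    have hS2 : S x ^ 2 ≤ 1 / 16 := by nlinarith [abs_lt.1 hxS]
    have h1 : c * (3 / 16) / ‖v‖ ^ ((1 : ℝ) / 3) *
        infDist x {q | ∃ t : ℝ, q = p + t • y} ^ ((1 : ℝ) / 3) ≤
        c * (3 / 16) * T x ^ ((1 : ℝ) / 3) := by
      refine (mul_le_mul_of_nonneg_left hpow (by positivity)).trans_eq ?_
      field_simp
    have h2 : c * T x ^ ((1 : ℝ) / 3) * (3 / 16) ≤
        c * T x ^ ((1 : ℝ) / 3) * (1 / 4 - S x ^ 2) :=
      mul_le_mul_of_nonneg_left (by linarith) (by positivity)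
    linarith
end
end

section
/- Let U ⊆ ℝ² be a convex open set whose boundary contains an open line segment I, and let u be a continuous convex function on closure(U) whose Monge–Ampère measure on U has density ≥ c for some constant c > 0, and such that u restricted to I is affine. Then u has infinite inner derivatives at every point of I: for every x₀ ∈ I and every x₁ ∈ U, lim_{t→0⁺}(u(x₀+t(x₁−x₀))−u(x₀))/t = −∞. -/
open Set Filter Topology MeasureTheory
open scoped RealInnerProductSpace ENNReal

noncomputable section

theorem volume_rectangle (a₁ b₁ a₂ b₂ : ℝ) :
    volume {p : En 2 | p 0 ∈ Icc a₁ b₁ ∧ p 1 ∈ Icc a₂ b₂} =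
      ENNReal.ofReal (b₁ - a₁) * ENNReal.ofReal (b₂ - a₂) := by
  have h : {p : En 2 | p 0 ∈ Icc a₁ b₁ ∧ p 1 ∈ Icc a₂ b₂} =
      WithLp.ofLp ⁻¹' (Icc ![a₁, a₂] ![b₁, b₂]) := by
    ext p
    simp [Pi.le_def, Fin.forall_fin_two]
    tauto
  rw [h, (PiLp.volume_preserving_ofLp (Fin 2)).measure_preimage
    measurableSet_Icc.nullMeasurableSet, Real.volume_Icc_pi]
  simp

/-- The linear map of the plane with rows `e` and `d`. -/
def pairing (e d : En 2) : En 2 →ₗ[ℝ] En 2 :=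
  Matrix.toLpLin 2 2 !![e 0, e 1; d 0, d 1]

theorem det_pairing (e d : En 2) : LinearMap.det (pairing e d) = e 0 * d 1 - e 1 * d 0 := by
  rw [pairing, Matrix.toLpLin_eq_toLin, LinearMap.det_toLin, Matrix.det_fin_two_of]

theorem pairing_apply_zero (e d p : En 2) : pairing e d p 0 = ⟪e, p⟫ := by
  simp [pairing, Matrix.toLpLin_apply, PiLp.inner_apply, dotProduct,
    Fin.sum_univ_two, mul_comm]

theorem pairing_apply_one (e d p : En 2) : pairing e d p 1 = ⟪d, p⟫ := by
  simp [pairing, Matrix.toLpLin_apply, PiLp.inner_apply, dotProduct,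
    Fin.sum_univ_two, mul_comm]

/-- The linear map of the plane with columns `e` and `d`. -/
def combination (e d : En 2) : En 2 →ₗ[ℝ] En 2 :=
  Matrix.toLpLin 2 2 !![e 0, d 0; e 1, d 1]

theorem det_combination (e d : En 2) :
    LinearMap.det (combination e d) = e 0 * d 1 - e 1 * d 0 := by
  rw [combination, Matrix.toLpLin_eq_toLin, LinearMap.det_toLin, Matrix.det_fin_two_of]
  ring

theorem combination_apply (e d q : En 2) : combination e d q = q 0 • e + q 1 • d := by
  ext i
  fin_cases i <;> simp [combination, Matrix.toLpLin_apply, dotProduct,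
    Fin.sum_univ_two, mul_comm]

/-- The parallelogram of the points `x + s • e + t • d` with `s ∈ [a₁, b₁]` and `t ∈ [a₂, b₂]`. -/
def parallelogram (x e d : En 2) (a₁ b₁ a₂ b₂ : ℝ) : Set (En 2) :=
  (fun z => x + z) '' (combination e d '' {q | q 0 ∈ Icc a₁ b₁ ∧ q 1 ∈ Icc a₂ b₂})

theorem volume_parallelogram (x e d : En 2) (a₁ b₁ a₂ b₂ : ℝ) :
    volume (parallelogram x e d a₁ b₁ a₂ b₂) = ENNReal.ofReal |e 0 * d 1 - e 1 * d 0| *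
      (ENNReal.ofReal (b₁ - a₁) * ENNReal.ofReal (b₂ - a₂)) := by
  rw [parallelogram, image_add_left, measure_preimage_add, Measure.addHaar_image_linearMap,
    det_combination, volume_rectangle]

theorem mem_parallelogram {x e d z : En 2} {a₁ b₁ a₂ b₂ : ℝ}
    (hz : z ∈ parallelogram x e d a₁ b₁ a₂ b₂) :
    ∃ s ∈ Icc a₁ b₁, ∃ t ∈ Icc a₂ b₂, z = x + s • e + t • d := by
  obtain ⟨_, ⟨q, ⟨hs, ht⟩, rfl⟩, rfl⟩ := hz
  exact ⟨q 0, hs, q 1, ht, by simp only [combination_apply, add_assoc]⟩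

theorem measurableSet_parallelogram (x e d : En 2) (a₁ b₁ a₂ b₂ : ℝ) :
    MeasurableSet (parallelogram x e d a₁ b₁ a₂ b₂) := by
  have h : {q : En 2 | q 0 ∈ Icc a₁ b₁ ∧ q 1 ∈ Icc a₂ b₂} =
      WithLp.toLp 2 '' (Icc ![a₁, a₂] ![b₁, b₂]) := by
    ext p
    constructor
    · rintro ⟨h₀, h₁⟩
      exact ⟨p.ofLp, by simp [Pi.le_def, Fin.forall_fin_two]; exact ⟨⟨h₀.1, h₁.1⟩, h₀.2, h₁.2⟩, rfl⟩
    · rintro ⟨q, hq, rfl⟩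
      simp [Pi.le_def, Fin.forall_fin_two] at hq
      exact ⟨⟨hq.1.1, hq.2.1⟩, hq.1.2, hq.2.2⟩
  have hc : IsCompact {q : En 2 | q 0 ∈ Icc a₁ b₁ ∧ q 1 ∈ Icc a₂ b₂} := by
    rw [h]
    exact isCompact_Icc.image (PiLp.continuous_toLp 2 _)
  exact ((hc.image (combination e d).continuous_of_finiteDimensional).image
    (continuous_const_add x)).measurableSet

theorem volume_pairing_mem_Icc (e d : En 2) (h : e 0 * d 1 - e 1 * d 0 ≠ 0) (a₁ b₁ a₂ b₂ : ℝ) :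
    volume {p : En 2 | ⟪e, p⟫ ∈ Icc a₁ b₁ ∧ ⟪d, p⟫ ∈ Icc a₂ b₂} =
      ENNReal.ofReal |(e 0 * d 1 - e 1 * d 0)⁻¹| *
        (ENNReal.ofReal (b₁ - a₁) * ENNReal.ofReal (b₂ - a₂)) := by
  rw [← volume_rectangle, ← det_pairing, ← Measure.addHaar_preimage_linearMap]
  · simp only [preimage_ofPred_eq, pairing_apply_zero, pairing_apply_one]
  · rwa [det_pairing]

/-- A direction pointing from a point of the boundary into an open convex set is independent of
any segment of its closure around that point. -/
theorem det_ne_zero_of_mem_frontier {U : Set (En 2)} (hc : Convex ℝ U) (ho : IsOpen U)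
    {x₀ e d : En 2} (hx₀ : x₀ ∈ frontier U) (he₀ : e ≠ 0)
    (he : ∀ s : ℝ, |s| ≤ 1 → x₀ + s • e ∈ closure U) (hd : x₀ + d ∈ U) :
    e 0 * d 1 - e 1 * d 0 ≠ 0 := by
  intro h
  obtain ⟨k, rfl⟩ : ∃ k : ℝ, d = k • e := by
    by_cases h0 : e 0 = 0
    · have h1 : e 1 ≠ 0 := by
        intro h1
        apply he₀
        ext i
        fin_cases i <;> simp [h0, h1]
      refine ⟨d 1 / e 1, ?_⟩
      ext i
      fin_cases i
      · simp [h0] at h ⊢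
        tauto
      · simp [h1]
    · refine ⟨d 0 / e 0, ?_⟩
      ext i
      fin_cases i
      · simp [h0]
      · simp
        field_simp
        linarith
  have hk : 0 < 1 + |k| := by positivity
  have hmem := he (-k / (1 + |k|)) (by
    rw [abs_div, abs_neg, abs_of_pos hk, div_le_one hk]; linarith)
  have hint := hc.combo_interior_closure_mem_interior (by rwa [ho.interior_eq]) hmem
    (a := 1 / (2 + |k|)) (b := (1 + |k|) / (2 + |k|)) (by positivity) (by positivity)
    (by field_simp; ring)
  have heq : (1 / (2 + |k|)) • (x₀ + k • e) +
      ((1 + |k|) / (2 + |k|)) • (x₀ + (-k / (1 + |k|)) • e) = x₀ := by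
    have h2 : 2 + |k| ≠ 0 := by positivity
    match_scalars
    · field_simp; ring
    · field_simp; ring
  rw [heq] at hint
  exact hx₀.2 hint

/-- If `u` is affine with slope `α` on the boundary segment in direction `e`, and lies above slope
`β` in the inner direction `d`, then subgradients at points near the boundary pair with `e` and `d`
to almost `α` and `β`. -/
theorem abs_inner_sub_le_of_mem_subgrad {U : Set (En 2)} (hc : Convex ℝ U) (ho : IsOpen U)
    {u : En 2 → ℝ} (hconv : ConvexOn ℝ (closure U) u) {x₀ e d : En 2} {α β ε h : ℝ}
    (he : ∀ s : ℝ, |s| ≤ 1 → x₀ + s • e ∈ closure U)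
    (hd : ∀ t ∈ Ioc (0 : ℝ) 1, x₀ + t • d ∈ U)
    (hα : ∀ s : ℝ, |s| ≤ 1 → u (x₀ + s • e) = u x₀ + s * α)
    (hβ : ∀ t ∈ Ioc (0 : ℝ) 1, u x₀ + t * β ≤ u (x₀ + t • d))
    (hε : ∀ t ∈ Ioc (0 : ℝ) h, u (x₀ + t • d) ≤ u x₀ + t * (β + ε)) (hh : h ≤ 1)
    {s t : ℝ} (hs : |s| ≤ 1 / 4) (ht : t ∈ Icc (h / 8) (h / 4)) (hh0 : 0 < h) :
    x₀ + s • e + t • d ∈ U ∧ ∀ p ∈ subgrad U u (x₀ + s • e + t • d),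
      |⟪e, p⟫ - α| ≤ ε * h ∧ |⟪d, p⟫ - β| ≤ 2 * ε := by
  have hmem : ∀ s t : ℝ, |s| ≤ 1 / 2 → t ∈ Ioc 0 (h / 2) → x₀ + s • e + t • d ∈ U := by
    intro s t hs ht
    have h1 := hc.combo_closure_interior_mem_interior (he (2 * s) (by
      rw [abs_mul, abs_two]; linarith)) (by
      rw [ho.interior_eq]; exact hd (2 * t) ⟨by linarith [ht.1], by linarith [ht.2]⟩)
      (a := 1 / 2) (b := 1 / 2) (by norm_num) (by norm_num) (by norm_num)
    rw [ho.interior_eq] at h1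
    convert h1 using 1
    module
  have hupper : ∀ s t : ℝ, |s| ≤ 1 / 2 → t ∈ Ioc 0 (h / 2) →
      u (x₀ + s • e + t • d) ≤ u x₀ + s * α + t * (β + ε) := by
    intro s t hs ht
    have hs2 : |2 * s| ≤ 1 := by rw [abs_mul, abs_two]; linarith
    have h1 := hconv.2 (he (2 * s) hs2)
      (subset_closure (hd (2 * t) ⟨by linarith [ht.1], by linarith [ht.2]⟩))
      (by norm_num : (0 : ℝ) ≤ 1 / 2) (by norm_num : (0 : ℝ) ≤ 1 / 2) (by norm_num)
    have h2 := hε (2 * t) ⟨by linarith [ht.1], by linarith [ht.2]⟩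
    have h3 : (1 / 2 : ℝ) • (x₀ + (2 * s) • e) + (1 / 2 : ℝ) • (x₀ + (2 * t) • d) =
        x₀ + s • e + t • d := by module
    rw [h3, hα _ hs2, smul_eq_mul, smul_eq_mul] at h1
    linarith
  have hlower : ∀ s t : ℝ, |s| ≤ 1 / 2 → t ∈ Ioc 0 (h / 2) →
      u x₀ + s * α + t * β ≤ u (x₀ + s • e + t • d) := by
    intro s t hs ht
    have hs2 : |-s| ≤ 1 := by rw [abs_neg]; linarith
    have h1 := hconv.2 (he (-s) hs2) (subset_closure (hmem s t hs ht))
      (by norm_num : (0 : ℝ) ≤ 1 / 2) (by norm_num : (0 : ℝ) ≤ 1 / 2) (by norm_num)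
    have h2 := hβ (t / 2) ⟨by linarith [ht.1], by linarith [ht.2]⟩
    have h3 : (1 / 2 : ℝ) • (x₀ + (-s) • e) + (1 / 2 : ℝ) • (x₀ + s • e + t • d) =
        x₀ + (t / 2) • d := by module
    rw [h3, hα _ hs2, smul_eq_mul, smul_eq_mul] at h1
    linarith
  obtain ⟨ht1, ht2⟩ := ht
  have hsb := abs_le.1 hs
  have hs' : |s| ≤ 1 / 2 := by linarith
  refine ⟨hmem s t hs' ⟨by linarith, by linarith⟩, fun p hp => ?_⟩
  have key : ∀ s' t' : ℝ, |s'| ≤ 1 / 2 → t' ∈ Ioc 0 (h / 2) →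
      (s' - s) * (⟪e, p⟫ - α) + (t' - t) * (⟪d, p⟫ - β) ≤ t' * ε := by
    intro s' t' hs1 ht'
    have h1 := hp _ (hmem s' t' hs1 ht')
    have h2 : x₀ + s' • e + t' • d - (x₀ + s • e + t • d) = (s' - s) • e + (t' - t) • d := by
      module
    rw [h2, inner_add_left, real_inner_smul_left, real_inner_smul_left] at h1
    have h3 := hupper s' t' hs1 ht'
    have h4 := hlower s t hs' ⟨by linarith, by linarith⟩
    linarith
  have hε0 : 0 ≤ ε := by
    have h1 := hβ h ⟨hh0, hh⟩
    have h2 := hε h ⟨hh0, le_rfl⟩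
    by_contra! h3
    nlinarith
  have k1 := key (s + 1 / 4) t (abs_le.2 ⟨by linarith, by linarith⟩) ⟨by linarith, by linarith⟩
  have k2 := key (s - 1 / 4) t (abs_le.2 ⟨by linarith, by linarith⟩) ⟨by linarith, by linarith⟩
  have k3 := key s (h / 2) hs' ⟨by linarith, by linarith⟩
  have k4 := key s (t / 2) hs' ⟨by linarith, by linarith⟩
  have hεt : t * ε ≤ h / 4 * ε := by gcongr
  refine ⟨abs_le.2 ⟨by linarith, by linarith⟩, abs_le.2 ⟨?_, ?_⟩⟩
  · by_contra! h3
    nlinarith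
  · by_contra! h3
    nlinarith

/-- A convex function whose difference quotients along a ray stay bounded below has a finite
one-sided slope there, which the quotients approach uniformly near the origin of the ray. -/
theorem exists_slope_of_bddBelow {φ : ℝ → ℝ} (hφ : ConvexOn ℝ (Icc 0 1) φ) {M : ℝ}
    (hM : ∀ t ∈ Ioc (0 : ℝ) 1, M ≤ (φ t - φ 0) / t) :
    ∃ β : ℝ, (∀ t ∈ Ioc (0 : ℝ) 1, φ 0 + t * β ≤ φ t) ∧
      ∀ ε > 0, ∃ h ∈ Ioc (0 : ℝ) 1, ∀ t ∈ Ioc (0 : ℝ) h, φ t ≤ φ 0 + t * (β + ε) := by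
  set S := (fun t => (φ t - φ 0) / t) '' Ioc (0 : ℝ) 1 with hS
  have hbdd : BddBelow S := ⟨M, by rintro _ ⟨t, ht, rfl⟩; exact hM t ht⟩
  have hne : S.Nonempty := ⟨_, 1, by simp, rfl⟩
  refine ⟨sInf S, fun t ht => ?_, fun ε hε => ?_⟩
  · have h1 : sInf S ≤ (φ t - φ 0) / t := csInf_le hbdd ⟨t, ht, rfl⟩
    rw [le_div_iff₀ ht.1] at h1
    linarith
  · obtain ⟨_, ⟨h, hh, rfl⟩, hlt⟩ := exists_lt_of_csInf_lt hne (lt_add_of_pos_right (sInf S) hε)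
    refine ⟨h, hh, fun t ht => ?_⟩
    have h1 := hφ.secant_mono (a := 0) (x := t) (y := h) (by simp)
      ⟨ht.1.le, ht.2.trans hh.2⟩ ⟨hh.1.le, hh.2⟩ ht.1.ne' hh.1.ne' ht.2
    rw [sub_zero, sub_zero] at h1
    have h2 := h1.trans hlt.le
    rw [div_le_iff₀ ht.1] at h2
    linarith

/-- The subgradients over a small parallelogram at the boundary are too few for the density bound
if the inner slope is finite. -/
theorem false_of_finite_inner_slope {U : Set (En 2)} (hc : Convex ℝ U) (ho : IsOpen U)
    {u : En 2 → ℝ} (hconv : ConvexOn ℝ (closure U) u) {c : ℝ} (hcpos : 0 < c)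
    (hMA : ∀ s : Set (En 2), MeasurableSet s → s ⊆ U →
      ENNReal.ofReal c * volume s ≤ MAmeasure U u s)
    {x₀ e d : En 2} {α β : ℝ} (hdet : e 0 * d 1 - e 1 * d 0 ≠ 0)
    (he : ∀ s : ℝ, |s| ≤ 1 → x₀ + s • e ∈ closure U)
    (hd : ∀ t ∈ Ioc (0 : ℝ) 1, x₀ + t • d ∈ U)
    (hα : ∀ s : ℝ, |s| ≤ 1 → u (x₀ + s • e) = u x₀ + s * α)
    (hβ : ∀ t ∈ Ioc (0 : ℝ) 1, u x₀ + t * β ≤ u (x₀ + t • d))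
    (hε : ∀ ε > 0, ∃ h ∈ Ioc (0 : ℝ) 1, ∀ t ∈ Ioc (0 : ℝ) h,
      u (x₀ + t • d) ≤ u x₀ + t * (β + ε)) : False := by
  set D := |e 0 * d 1 - e 1 * d 0| with hD
  have hDpos : 0 < D := abs_pos.2 hdet
  set ε := D * √c / 12 with hεdef
  have hε0 : 0 < ε := by positivity
  obtain ⟨h, ⟨hh0, hh1⟩, hh⟩ := hε ε hε0
  have hE := fun s hs t ht => abs_inner_sub_le_of_mem_subgrad (s := s) (t := t) hc ho hconv
    he hd hα hβ hh hh1 (abs_le.2 hs) ht hh0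
  set E := parallelogram x₀ e d (-(1 / 4)) (1 / 4) (h / 8) (h / 4) with hEdef
  have hEU : E ⊆ U := by
    intro z hz
    obtain ⟨s, hs, t, ht, rfl⟩ := mem_parallelogram hz
    exact (hE s hs t ht).1
  have hsub : (⋃ x ∈ E, subgrad U u x) ⊆
      {p : En 2 | ⟪e, p⟫ ∈ Icc (α - ε * h) (α + ε * h) ∧
        ⟪d, p⟫ ∈ Icc (β - 2 * ε) (β + 2 * ε)} := by
    intro p hp
    obtain ⟨z, hz, hpz⟩ := mem_iUnion₂.1 hp
    obtain ⟨s, hs, t, ht, rfl⟩ := mem_parallelogram hz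
    obtain ⟨h1, h2⟩ := (hE s hs t ht).2 p hpz
    rw [abs_le] at h1 h2
    exact ⟨⟨by linarith, by linarith⟩, ⟨by linarith, by linarith⟩⟩
  have hle := (hMA E (measurableSet_parallelogram ..) hEU).trans (measure_mono hsub)
  rw [hEdef, volume_parallelogram, volume_pairing_mem_Icc e d hdet, abs_inv, ← hD,
    ← ENNReal.ofReal_mul (by norm_num), ← ENNReal.ofReal_mul hDpos.le,
    ← ENNReal.ofReal_mul hcpos.le, ← ENNReal.ofReal_mul (by nlinarith),
    ← ENNReal.ofReal_mul (by positivity), ENNReal.ofReal_le_ofReal_iff (by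
      refine mul_nonneg (by positivity) (mul_nonneg ?_ ?_) <;> nlinarith)] at hle
  have hsq : ε * ε = D ^ 2 * c / 144 := by
    rw [hεdef]
    linear_combination D ^ 2 / 144 * Real.mul_self_sqrt hcpos.le
  have hrhs : D⁻¹ * ((α + ε * h - (α - ε * h)) * (β + 2 * ε - (β - 2 * ε))) =
      D * c * h / 18 := by
    field_simp
    linear_combination 144 * h * hsq
  rw [hrhs] at hle
  have : 0 < D * c * h := by positivity
  linarith

theorem stmt18 (U : Set (En 2))
    (hc : Convex ℝ U) (ho : IsOpen U)
    (I : Set (En 2)) (a b : En 2) (hab : a ≠ b) (hI : I = openSegment ℝ a b)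
    (hIfr : I ⊆ frontier U)
    (u : En 2 → ℝ) (hcont : ContinuousOn u (closure U))
    (hconv : ConvexOn ℝ (closure U) u)
    (c : ℝ) (hcpos : 0 < c)
    (hMA : ∀ s : Set (En 2), MeasurableSet s → s ⊆ U →
      ENNReal.ofReal c * volume s ≤ MAmeasure U u s)
    (haff : ∃ y : En 2, ∃ η : ℝ, ∀ x ∈ I, u x = ⟪x, y⟫ + η) :
    ∀ x₀ ∈ I, ∀ x₁ ∈ U,
      Tendsto (fun t : ℝ => (u (x₀ + t • (x₁ - x₀)) - u x₀) / t)
        (𝓝[>] 0) atBot := by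
  intro x₀ hx₀ x₁ hx₁
  obtain ⟨y, η, haff⟩ := haff
  have hcl : ∀ x ∈ I, x ∈ closure U := fun x hx => frontier_subset_closure (hIfr hx)
  obtain ⟨e, he0, heI⟩ : ∃ e : En 2, e ≠ 0 ∧ ∀ s : ℝ, |s| ≤ 1 → x₀ + s • e ∈ I := by
    subst hI
    obtain ⟨p, q, hp, hq, hpq, rfl⟩ := hx₀
    have hr : 0 < min p q / 2 := by positivity
    refine ⟨(min p q / 2) • (b - a), smul_ne_zero hr.ne' (sub_ne_zero.2 hab.symm), fun s hs => ?_⟩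
    rw [abs_le] at hs
    have h1 := min_le_left p q
    have h2 := min_le_right p q
    exact ⟨p - s * (min p q / 2), q + s * (min p q / 2), by nlinarith, by nlinarith,
      by linarith, by module⟩
  have he := fun s hs => hcl _ (heI s hs)
  have hd : ∀ t ∈ Ioc (0 : ℝ) 1, x₀ + t • (x₁ - x₀) ∈ U := by
    intro t ht
    have h1 := hc.combo_closure_interior_mem_interior (hcl x₀ hx₀)
      (by rwa [ho.interior_eq] : x₁ ∈ interior U) (sub_nonneg.2 ht.2) ht.1 (by ring)
    rw [ho.interior_eq] at h1
    convert h1 using 1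
    module
  have hα : ∀ s : ℝ, |s| ≤ 1 → u (x₀ + s • e) = u x₀ + s * ⟪e, y⟫ := by
    intro s hs
    rw [haff _ (heI s hs), haff _ hx₀, inner_add_left, real_inner_smul_left]
    ring
  have hφ : ConvexOn ℝ (Icc (0 : ℝ) 1) fun t => u (x₀ + t • (x₁ - x₀)) := by
    have h1 := hconv.comp_affineMap (AffineMap.lineMap x₀ x₁)
    refine (h1.subset ?_ (convex_Icc 0 1)).congr ?_
    · intro t ht
      exact hc.closure.lineMap_mem (hcl _ hx₀) (subset_closure hx₁) ht
    · intro t _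
      simp [AffineMap.lineMap_apply, add_comm]
  rw [tendsto_atBot]
  intro M
  by_contra hM
  have hbelow : ∀ t ∈ Ioc (0 : ℝ) 1, M ≤ (u (x₀ + t • (x₁ - x₀)) - u x₀) / t := by
    intro t₀ ht₀
    by_contra! hlt
    apply hM
    filter_upwards [Ioc_mem_nhdsGT ht₀.1] with t ht
    have h1 := hφ.secant_mono (a := 0) (x := t) (y := t₀) (by simp)
      ⟨ht.1.le, ht.2.trans ht₀.2⟩ ⟨ht₀.1.le, ht₀.2⟩ ht.1.ne' ht₀.1.ne' ht.2
    simp only [sub_zero, zero_smul, add_zero] at h1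
    exact h1.trans hlt.le
  obtain ⟨β, hβ, hε⟩ := exists_slope_of_bddBelow hφ (M := M) (by simpa using hbelow)
  simp only [zero_smul, add_zero] at hβ hε
  exact false_of_finite_inner_slope hc ho hconv hcpos hMA
    (det_ne_zero_of_mem_frontier hc ho (hIfr hx₀) he0 he (by simpa using hx₁)) he hd hα hβ hε
end
end

section
/- Let Δ ⊆ ℝ² be an open triangle with a vertex x₀, and let u be a continuous convex function on closure(Δ) with u = 0 on ∂Δ whose Monge–Ampère measure has density bounded above by c|x − x₀|^α on Δ for some constants c > 0 and α > −2. Then u has finite inner derivatives at x₀: for some x₁ ∈ Δ, lim_{t→0⁺}(u(x₀+t(x₁−x₀))−u(x₀))/t > −∞. -/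
open Set Filter Topology MeasureTheory
open scoped RealInnerProductSpace ENNReal

noncomputable section

/-- Sliding planes: if `w ≤ u` on `∂U`, a subgradient of `w` at a point of `{u < w}` is a
subgradient of `u` at some other point of `{u < w}`. -/
theorem image_subset_iUnion_subgrad {n : ℕ} {U : Set (En n)} (hU : IsOpen U)
    (hb : IsCompact (closure U)) {u w : En n → ℝ} (hu : ContinuousOn u (closure U))
    (hle : ∀ x ∈ frontier U, w x ≤ u x) {F : En n → En n}
    (hF : ∀ x ∈ U, F x ∈ subgrad (closure U) w x) :
    F '' {x ∈ U | u x < w x} ⊆ ⋃ x ∈ {x ∈ U | u x < w x}, subgrad U u x := by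
  rintro _ ⟨x, ⟨hxU, hx⟩, rfl⟩
  have hxc := subset_closure hxU
  obtain ⟨y, hy, hmin⟩ := hb.exists_isMinOn ⟨x, hxc⟩
    (f := fun z => u z - ⟪z - x, F x⟫) (hu.sub (by fun_prop))
  have hyx := hmin hxc
  simp only [mem_ofPred_eq, sub_self, inner_zero_left, sub_zero] at hyx
  have hwy := hF x hxU y hy
  have huy : u y < w y := by linarith
  have hyU : y ∈ U := by
    by_contra hyU
    exact huy.not_ge (hle y (by rw [hU.frontier_eq]; exact ⟨hy, hyU⟩))
  refine mem_biUnion (x := y) ⟨hyU, huy⟩ fun z hz => ?_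
  have hyz := hmin (subset_closure hz)
  simp only [mem_ofPred_eq] at hyz
  have : ⟪z - y, F x⟫ = ⟪z - x, F x⟫ - ⟪y - x, F x⟫ := by
    rw [← inner_sub_left, sub_sub_sub_cancel_right]
  linarith

theorem det_smul_id_add_smul_inner_smulRight (a b : ℝ) (y : En 2) :
    (a • ContinuousLinearMap.id ℝ (En 2) + b • (innerSL ℝ y).smulRight y).det
      = a ^ 2 + a * b * ‖y‖ ^ 2 := by
  have hn : ‖y‖ ^ 2 = y 0 ^ 2 + y 1 ^ 2 := by
    simp [EuclideanSpace.norm_sq_eq]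
  rw [ContinuousLinearMap.det,
    ← LinearMap.det_toMatrix (EuclideanSpace.basisFun (Fin 2) ℝ).toBasis, Matrix.det_fin_two, hn]
  simp [LinearMap.toMatrix_apply, EuclideanSpace.inner_single_right]
  ring

theorem hasFDerivAt_norm_rpow_smul {E : Type*} [NormedAddCommGroup E] [InnerProductSpace ℝ E]
    (p : ℝ) {y : E} (hy : y ≠ 0) :
    HasFDerivAt (fun x : E => ‖x‖ ^ p • x)
      (‖y‖ ^ p • ContinuousLinearMap.id ℝ E
        + (p * ‖y‖ ^ (p - 2)) • (innerSL ℝ y).smulRight y) y := by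
  have hy0 : 0 < ‖y‖ := norm_pos_iff.2 hy
  have hpow (x : E) (q : ℝ) : (‖x‖ ^ 2) ^ (q / 2) = ‖x‖ ^ q := by
    rw [← Real.rpow_natCast_mul (norm_nonneg x)]
    congr 1
    push_cast
    ring
  have h := ((hasStrictFDerivAt_norm_sq y).hasFDerivAt.rpow_const (p := p / 2)
    (Or.inl (by positivity))).smul (hasFDerivAt_id y)
  simp only [hpow, show p / 2 - 1 = (p - 2) / 2 by ring] at h
  refine h.congr_fderiv ?_
  ext v
  simp [smul_smul]
  congr 1
  ring

theorem norm_rpow_smul_injOn {E : Type*} [NormedAddCommGroup E] [NormedSpace ℝ E]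
    {p : ℝ} (hp : -1 < p) : InjOn (fun x : E => ‖x‖ ^ p • x) {0}ᶜ := by
  intro x hx y hy h
  have hx0 : 0 < ‖x‖ := norm_pos_iff.2 hx
  have hy0 : 0 < ‖y‖ := norm_pos_iff.2 hy
  have hn := congrArg norm h
  simp only [norm_smul, Real.norm_rpow_of_nonneg (norm_nonneg _), norm_norm] at hn
  rw [← Real.rpow_add_one hx0.ne', ← Real.rpow_add_one hy0.ne',
    Real.rpow_left_inj hx0.le hy0.le (by linarith)] at hn
  simp only [hn] at h
  exact smul_right_injective E (Real.rpow_pos_of_pos hy0 p).ne' h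

theorem volume_image_norm_rpow_smul {k α : ℝ} (hk : 0 < k) (hα : -2 < α) (x₀ L : En 2)
    {S : Set (En 2)} (hS : MeasurableSet S) (hx₀ : x₀ ∉ S) :
    volume ((fun x => k • ‖x - x₀‖ ^ (α / 2) • (x - x₀) - L) '' S)
      = ∫⁻ x in S, ENNReal.ofReal (k ^ 2 * (1 + α / 2) * dist x x₀ ^ α) := by
  have hne : ∀ x ∈ S, x - x₀ ≠ 0 := fun x hx h => hx₀ (sub_eq_zero.1 h ▸ hx)
  rw [← lintegral_abs_det_fderiv_eq_addHaar_image volume hS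
    (f' := fun x => (k * ‖x - x₀‖ ^ (α / 2)) • ContinuousLinearMap.id ℝ (En 2)
      + (k * (α / 2 * ‖x - x₀‖ ^ (α / 2 - 2))) • (innerSL ℝ (x - x₀)).smulRight (x - x₀))]
  · refine setLIntegral_congr_fun hS fun x hx => ?_
    have hr : 0 < ‖x - x₀‖ := norm_pos_iff.2 (hne x hx)
    have h1 : ‖x - x₀‖ ^ α = (‖x - x₀‖ ^ (α / 2)) ^ 2 := by
      rw [← Real.rpow_mul_natCast hr.le]
      congr 1
      push_cast
      ring
    have h2 : ‖x - x₀‖ ^ (α / 2 - 2) * ‖x - x₀‖ ^ 2 = ‖x - x₀‖ ^ (α / 2) := by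
      rw [← Real.rpow_add_natCast hr.ne']
      congr 1
      push_cast
      ring
    have hdet : (k * ‖x - x₀‖ ^ (α / 2)) ^ 2
        + k * ‖x - x₀‖ ^ (α / 2) * (k * (α / 2 * ‖x - x₀‖ ^ (α / 2 - 2))) * ‖x - x₀‖ ^ 2
        = k ^ 2 * (1 + α / 2) * dist x x₀ ^ α := by
      rw [dist_eq_norm, h1]
      linear_combination (k ^ 2 * (α / 2) * ‖x - x₀‖ ^ (α / 2)) * h2
    have hpos : 0 < 1 + α / 2 := by linarith
    simp only [det_smul_id_add_smul_inner_smulRight, hdet]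
    rw [abs_of_nonneg (by positivity)]
  · intro x hx
    have h := (((hasFDerivAt_norm_rpow_smul (α / 2) (hne x hx)).comp x
      ((hasFDerivAt_id x).sub_const x₀)).const_smul k).sub_const L
    refine (h.congr_fderiv ?_).hasFDerivWithinAt
    ext v
    simp [smul_smul, mul_assoc]
  · intro x hx y hy h
    have h' := smul_right_injective _ hk.ne' (sub_left_injective h)
    exact sub_left_injective
      (norm_rpow_smul_injOn (by linarith) (hne x hx) (hne y hy) h')

theorem rpow_add_mul_sub_le_rpow {a b β : ℝ} (ha : 0 < a) (hb : 0 ≤ b) (hβ : 1 ≤ β) :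
    a ^ β + β * a ^ (β - 1) * (b - a) ≤ b ^ β := by
  have h := one_add_mul_self_le_rpow_one_add (s := b / a - 1)
    (by linarith [div_nonneg hb ha.le]) hβ
  rw [add_sub_cancel, Real.div_rpow hb ha.le, le_div_iff₀ (by positivity)] at h
  refine le_trans (le_of_eq ?_) h
  rw [Real.rpow_sub_one ha.ne']
  field_simp

theorem smul_norm_rpow_mem_subgrad {n : ℕ} {k p : ℝ} (hk : 0 < k) (hp : -1 < p)
    (U : Set (En n)) {x₀ x : En n} (L : En n) (hx : x ≠ x₀) :
    k • ‖x - x₀‖ ^ p • (x - x₀) - L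
      ∈ subgrad U (fun z => k / (p + 2) * ‖z - x₀‖ ^ (p + 2) - ⟪z - x₀, L⟫) x := by
  intro z _
  have hr : 0 < ‖x - x₀‖ := norm_pos_iff.2 (sub_ne_zero.2 hx)
  have hz : z - x = (z - x₀) - (x - x₀) := by abel
  have h := rpow_add_mul_sub_le_rpow hr (norm_nonneg (z - x₀)) (β := p + 2) (by linarith)
  have hpow : ‖x - x₀‖ ^ (p + 2 - 1) = ‖x - x₀‖ ^ p * ‖x - x₀‖ := by
    rw [← Real.rpow_add_one hr.ne']
    congr 1
    ring
  rw [hpow] at h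
  have hin := mul_le_mul_of_nonneg_left (real_inner_le_norm (z - x₀) (x - x₀))
    (Real.rpow_nonneg hr.le p)
  have hp2 : 0 < p + 2 := by linarith
  have h' := mul_le_mul_of_nonneg_left h (div_pos hk hp2).le
  have hin' := mul_le_mul_of_nonneg_left hin hk.le
  have e : k / (p + 2) * (‖x - x₀‖ ^ (p + 2)
        + (p + 2) * (‖x - x₀‖ ^ p * ‖x - x₀‖) * (‖z - x₀‖ - ‖x - x₀‖))
      = k / (p + 2) * ‖x - x₀‖ ^ (p + 2)
        + k * (‖x - x₀‖ ^ p * ‖x - x₀‖) * (‖z - x₀‖ - ‖x - x₀‖) := by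
    field_simp
  rw [e] at h'
  have hinner : ⟪z - x, k • ‖x - x₀‖ ^ p • (x - x₀) - L⟫
      = k * (‖x - x₀‖ ^ p * (⟪z - x₀, x - x₀⟫ - ‖x - x₀‖ ^ 2))
        - ⟪z - x₀, L⟫ + ⟪x - x₀, L⟫ := by
    rw [hz]
    generalize x - x₀ = d
    simp only [inner_sub_right, inner_smul_right, inner_sub_left, real_inner_self_eq_norm_sq]
    ring
  simp only [hinner]
  linarith

theorem norm_rpow_smul_le {E : Type*} [NormedAddCommGroup E] [NormedSpace ℝ E]
    {p R : ℝ} (hp : -1 < p) {y : E} (hy : y ≠ 0) (hR : ‖y‖ ≤ R) :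
    ‖‖y‖ ^ p • y‖ ≤ R ^ (p + 1) := by
  rw [norm_smul, Real.norm_rpow_of_nonneg (norm_nonneg _), norm_norm,
    ← Real.rpow_add_one (norm_pos_iff.2 hy).ne']
  exact Real.rpow_le_rpow (norm_nonneg _) hR (by linarith)

/-- Comparison principle against a multiple of `|x - x₀| ^ (α / 2 + 2)` minus a linear function. -/
theorem norm_rpow_sub_inner_le {U : Set (En 2)} (hU : IsOpen U) (hb : IsCompact (closure U))
    {x₀ : En 2} (hx₀ : x₀ ∉ U) {u : En 2 → ℝ} (hu : ContinuousOn u (closure U))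
    {c α k : ℝ} (hc : 0 < c) (hα : -2 < α) (hk : 0 < k) (hck : c < k ^ 2 * (1 + α / 2))
    (hMA : ∀ s : Set (En 2), MeasurableSet s → s ⊆ U →
      MAmeasure U u s ≤ ∫⁻ x in s, ENNReal.ofReal (c * dist x x₀ ^ α) ∂volume)
    (L : En 2) (hle : ∀ x ∈ frontier U,
      k / (α / 2 + 2) * ‖x - x₀‖ ^ (α / 2 + 2) - ⟪x - x₀, L⟫ ≤ u x) {x : En 2} (hx : x ∈ U) :
    k / (α / 2 + 2) * ‖x - x₀‖ ^ (α / 2 + 2) - ⟪x - x₀, L⟫ ≤ u x := by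
  by_contra! hlt
  set w : En 2 → ℝ := fun x => k / (α / 2 + 2) * ‖x - x₀‖ ^ (α / 2 + 2) - ⟪x - x₀, L⟫
  set F : En 2 → En 2 := fun x => k • ‖x - x₀‖ ^ (α / 2) • (x - x₀) - L
  set G := {x ∈ U | u x < w x} with hG
  have hne : ∀ y ∈ U, y ≠ x₀ := fun y hy h => hx₀ (h ▸ hy)
  have hwc : Continuous w := by
    have : Continuous fun x : En 2 => ‖x - x₀‖ ^ (α / 2 + 2) :=
      (by fun_prop : Continuous fun x : En 2 => ‖x - x₀‖).rpow_const
        fun _ => Or.inr (by linarith)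
    fun_prop
  have hGo : IsOpen G := by
    have := ((hwc.continuousOn.sub (hu.mono subset_closure)).isOpen_inter_preimage hU
      (isOpen_Ioi (a := (0 : ℝ))))
    convert this using 1
    ext y
    simp [hG]
  have hGx₀ : x₀ ∉ G := fun h => hx₀ h.1
  have hsub := image_subset_iUnion_subgrad hU hb hu (w := w) hle (F := F)
    fun y hy => smul_norm_rpow_mem_subgrad hk (by linarith) _ L (hne y hy)
  have hvol := volume_image_norm_rpow_smul hk hα x₀ L hGo.measurableSet hGx₀
  have hkey := (measure_mono hsub).trans (hMA G hGo.measurableSet fun y hy => hy.1)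
  have hfin : volume (F '' G) ≠ ∞ := by
    obtain ⟨R, hR⟩ := hb.isBounded.exists_norm_le
    refine (Bornology.IsBounded.measure_lt_top (isBounded_iff_forall_norm_le.2
      ⟨k * (R + ‖x₀‖) ^ (α / 2 + 1) + ‖L‖, ?_⟩)).ne
    rintro _ ⟨y, hy, rfl⟩
    have h1 : ‖y - x₀‖ ≤ R + ‖x₀‖ :=
      (norm_sub_le _ _).trans (by gcongr; exact hR y (subset_closure hy.1))
    refine (norm_sub_le _ _).trans ?_
    rw [norm_smul, Real.norm_of_nonneg hk.le]
    gcongr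
    exact norm_rpow_smul_le (by linarith) (sub_ne_zero.2 (hne y hy.1)) h1
  have hm : Measurable fun y : En 2 => ENNReal.ofReal (dist y x₀ ^ α) := by fun_prop
  have hpull (a : ℝ) (ha : 0 < a) : ∫⁻ y in G, ENNReal.ofReal (a * dist y x₀ ^ α)
      = ENNReal.ofReal a * ∫⁻ y in G, ENNReal.ofReal (dist y x₀ ^ α) := by
    simp only [ENNReal.ofReal_mul ha.le]
    exact lintegral_const_mul _ hm
  have hI : 0 < ∫⁻ y in G, ENNReal.ofReal (dist y x₀ ^ α) := by
    rw [setLIntegral_pos_iff hm]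
    refine (hGo.measure_pos volume ⟨x, hx, hlt⟩).trans_le (measure_mono fun y hy => ⟨?_, hy⟩)
    have := dist_pos.2 (hne y hy.1)
    simp only [Function.mem_support, ne_eq, ENNReal.ofReal_eq_zero, not_le]
    positivity
  rw [hpull _ (hc.trans hck)] at hvol
  rw [hpull _ hc, hvol] at hkey
  rw [hvol] at hfin
  have hI' : ∫⁻ y in G, ENNReal.ofReal (dist y x₀ ^ α) ≠ ∞ := fun h => hfin (by
    rw [h, ENNReal.mul_top (by simpa using hc.trans hck)])
  rw [ENNReal.mul_le_mul_iff_left hI.ne' hI', ENNReal.ofReal_le_ofReal_iff hc.le] at hkey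
  linarith

/-- The linear functional taking the value `1` on two independent vectors of the plane. -/
theorem exists_inner_eq_one {e₁ e₂ : En 2} (h : LinearIndependent ℝ ![e₁, e₂]) :
    ∃ L : En 2, ⟪e₁, L⟫ = 1 ∧ ⟪e₂, L⟫ = 1 := by
  let b := basisOfLinearIndependentOfCardEqFinrank h (by simp)
  let f : En 2 →L[ℝ] ℝ := LinearMap.toContinuousLinearMap (b.constr ℝ fun _ => (1 : ℝ))
  have hb (i : Fin 2) : f (![e₁, e₂] i) = 1 := by
    have : b i = ![e₁, e₂] i := by simp [b]
    rw [← this]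
    simp [f]
  refine ⟨(InnerProductSpace.toDual ℝ (En 2)).symm f, ?_, ?_⟩ <;>
    rw [real_inner_comm, InnerProductSpace.toDual_symm_apply]
  exacts [hb 0, hb 1]

theorem ConvexOn.exists_tendsto_div_nhdsGT_zero {g : ℝ → ℝ} (hg : ConvexOn ℝ (Icc 0 1) g)
    {m : ℝ} (hm : ∀ t ∈ Ioc (0 : ℝ) 1, m ≤ (g t - g 0) / t) :
    ∃ l : ℝ, Tendsto (fun t => (g t - g 0) / t) (𝓝[>] 0) (𝓝 l) := by
  have hmono : MonotoneOn (fun t => (g t - g 0) / t) (Ioo 0 1) := by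
    intro s hs t ht hst
    simpa using hg.secant_mono (a := 0) (by simp) (Ioo_subset_Icc_self hs)
      (Ioo_subset_Icc_self ht) hs.1.ne' ht.1.ne' hst
  have h := hmono.tendsto_nhdsWithin_Ioo_right (by simp)
    ⟨m, by rintro _ ⟨t, ht, rfl⟩; exact hm t (Ioo_subset_Ioc_self ht)⟩
  exact ⟨_, h⟩

theorem exists_of_mem_convexHull_triple {x₀ v₁ v₂ x : En 2}
    (hx : x ∈ convexHull ℝ {x₀, v₁, v₂}) :
    ∃ a b : ℝ, 0 ≤ a ∧ 0 ≤ b ∧ a + b ≤ 1 ∧ x - x₀ = a • (v₁ - x₀) + b • (v₂ - x₀) := by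
  rw [convexHull_insert (by simp), convexHull_pair, mem_convexJoin] at hx
  obtain ⟨y, rfl, z, ⟨s, t, hs, ht, hst, rfl⟩, ⟨p, q, hp, hq, hpq, rfl⟩⟩ := hx
  refine ⟨q * s, q * t, by positivity, by positivity, ?_, ?_⟩
  · rw [← mul_add, hst]; linarith
  · obtain rfl : p = 1 - q := by linarith
    obtain rfl : s = 1 - t := by linarith
    module

theorem exists_inner_eq_add {x₀ v₁ v₂ : En 2} (hind : AffineIndependent ℝ ![x₀, v₁, v₂]) :
    ∃ L : En 2, ∀ a b : ℝ, ⟪a • (v₁ - x₀) + b • (v₂ - x₀), L⟫ = a + b := by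
  have h := ((affineIndependent_iff_linearIndependent_vsub ℝ _ 0).1 hind).comp
    (fun i : Fin 2 => ⟨i.succ, i.succ_ne_zero⟩)
    fun i j hij => Fin.succ_injective 2 (congrArg Subtype.val hij)
  obtain ⟨L, h₁, h₂⟩ := exists_inner_eq_one (e₁ := v₁ - x₀) (e₂ := v₂ - x₀) (by
    convert h using 1
    · ext i : 1
      fin_cases i <;> rfl
    · rfl)
  refine ⟨L, fun a b => ?_⟩
  rw [inner_add_left, real_inner_smul_left, real_inner_smul_left, h₁, h₂]
  ring

/-- Every convex power of the distance to a vertex is dominated on a triangle by a linear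
function vanishing at the vertex. -/
theorem exists_norm_rpow_le_inner {x₀ v₁ v₂ : En 2} (hind : AffineIndependent ℝ ![x₀, v₁, v₂])
    {β : ℝ} (hβ : 1 ≤ β) {A : ℝ} (hA : 0 ≤ A) :
    ∃ L : En 2, ∀ x ∈ convexHull ℝ {x₀, v₁, v₂}, A * ‖x - x₀‖ ^ β ≤ ⟪x - x₀, L⟫ := by
  obtain ⟨L, hL⟩ := exists_inner_eq_add hind
  set R := ‖v₁ - x₀‖ + ‖v₂ - x₀‖ with hR
  refine ⟨(A * R ^ β) • L, fun x hx => ?_⟩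
  obtain ⟨a, b, ha, hb, hab, hx⟩ := exists_of_mem_convexHull_triple hx
  have hab0 : 0 ≤ a + b := by positivity
  have hR0 : 0 ≤ R := by positivity
  have hnorm : ‖x - x₀‖ ≤ (a + b) * R := by
    rw [hx]
    refine (norm_add_le _ _).trans ?_
    rw [norm_smul, norm_smul, Real.norm_of_nonneg ha, Real.norm_of_nonneg hb, hR]
    nlinarith [mul_nonneg ha (norm_nonneg (v₂ - x₀)), mul_nonneg hb (norm_nonneg (v₁ - x₀))]
  have hpow : ‖x - x₀‖ ^ β ≤ (a + b) * R ^ β := calc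
    ‖x - x₀‖ ^ β ≤ ((a + b) * R) ^ β := by gcongr
    _ = (a + b) ^ β * R ^ β := Real.mul_rpow hab0 hR0
    _ ≤ (a + b) * R ^ β := by
      gcongr
      exact Real.rpow_le_self_of_le_one hab0 hab hβ
  rw [inner_smul_right, hx, hL, ← hx]
  linarith [mul_le_mul_of_nonneg_left hpow hA]

theorem vertex_notMem_interior {x₀ v₁ v₂ : En 2} (hind : AffineIndependent ℝ ![x₀, v₁, v₂]) :
    x₀ ∉ interior (convexHull ℝ {x₀, v₁, v₂}) := by
  intro h
  obtain ⟨L, hL⟩ := exists_inner_eq_add hind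
  have hcont : Tendsto (fun t : ℝ => x₀ - t • (v₁ - x₀)) (𝓝[>] 0) (𝓝 x₀) := by
    have : Continuous fun t : ℝ => x₀ - t • (v₁ - x₀) := by fun_prop
    simpa using (this.tendsto 0).mono_left nhdsWithin_le_nhds
  obtain ⟨t, ht, ht0⟩ := ((hcont.eventually (mem_interior_iff_mem_nhds.1 h)).and
    self_mem_nhdsWithin).exists
  obtain ⟨a, b, ha, hb, -, hx⟩ := exists_of_mem_convexHull_triple ht
  have h1 := hL a b
  have h2 := hL (-t) 0
  rw [← hx] at h1
  rw [show (-t) • (v₁ - x₀) + (0 : ℝ) • (v₂ - x₀) = x₀ - t • (v₁ - x₀) - x₀ by module, h1] at h2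
  have : 0 < t := ht0
  linarith

theorem stmt19 (x₀ v₁ v₂ : En 2)
    (hind : AffineIndependent ℝ ![x₀, v₁, v₂])
    (Δ : Set (En 2)) (hΔ : Δ = interior (convexHull ℝ {x₀, v₁, v₂}))
    (u : En 2 → ℝ) (hcont : ContinuousOn u (closure Δ))
    (hconv : ConvexOn ℝ (closure Δ) u)
    (hbdry : ∀ x ∈ frontier Δ, u x = 0)
    (c α : ℝ) (hcpos : 0 < c) (hα : -2 < α)
    (hMA : ∀ s : Set (En 2), MeasurableSet s → s ⊆ Δ →
      MAmeasure Δ u s ≤ ∫⁻ x in s, ENNReal.ofReal (c * dist x x₀ ^ α) ∂volume) :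
    ∃ x₁ ∈ Δ, ∃ m : ℝ,
      Tendsto (fun t : ℝ => (u (x₀ + t • (x₁ - x₀)) - u x₀) / t)
        (𝓝[>] 0) (𝓝 m) := by
  set T := convexHull ℝ {x₀, v₁, v₂} with hT
  have hTconv : Convex ℝ T := convex_convexHull ℝ _
  have hTcomp : IsCompact T := (toFinite ({x₀, v₁, v₂} : Set (En 2))).isCompact_convexHull ℝ
  have hΔo : IsOpen Δ := hΔ ▸ isOpen_interior
  have hx₀T : x₀ ∈ T := subset_convexHull ℝ _ (by simp)
  have hx₀ : x₀ ∉ Δ := hΔ ▸ vertex_notMem_interior hind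
  have hne : (interior T).Nonempty := by
    rw [hT, interior_convexHull_nonempty_iff_affineSpan_eq_top]
    have h := hind.affineSpan_eq_top_iff_card_eq_finrank_add_one.2 (by simp)
    rwa [Matrix.range_cons, Matrix.range_cons, Matrix.range_cons, Matrix.range_empty, union_empty,
      singleton_union, singleton_union] at h
  have hcl : closure Δ = T := by
    rw [hΔ, hTconv.closure_interior_eq_closure_of_nonempty_interior hne,
      hTcomp.isClosed.closure_eq]
  have hux₀ : u x₀ = 0 := hbdry x₀ (by rw [hΔo.frontier_eq, hcl]; exact ⟨hx₀T, hx₀⟩)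
  have hpos : 0 < 1 + α / 2 := by linarith
  obtain ⟨k, hk, hck⟩ : ∃ k : ℝ, 0 < k ∧ c < k ^ 2 * (1 + α / 2) := by
    refine ⟨√(2 * c / (1 + α / 2)), by positivity, ?_⟩
    rw [Real.sq_sqrt (by positivity), div_mul_cancel₀ _ hpos.ne']
    linarith
  have hA : 0 ≤ k / (α / 2 + 2) := div_nonneg hk.le (by linarith)
  obtain ⟨L, hL⟩ := exists_norm_rpow_le_inner hind (β := α / 2 + 2) (by linarith) hA
  have hcomp : ∀ x ∈ Δ, - ⟪x - x₀, L⟫ ≤ u x := fun x hx => by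
    have h := norm_rpow_sub_inner_le hΔo (hcl ▸ hTcomp) hx₀ hcont hcpos hα hk hck hMA L
      (fun y hy => by
        rw [hbdry y hy]
        linarith [hL y (hcl.subset (frontier_subset_closure hy))]) hx
    have : 0 ≤ k / (α / 2 + 2) * ‖x - x₀‖ ^ (α / 2 + 2) := by positivity
    linarith
  obtain ⟨x₁, hx₁⟩ := hne
  have hmem : ∀ t ∈ Ioc (0 : ℝ) 1, x₀ + t • (x₁ - x₀) ∈ Δ := fun t ht => by
    have h := hTconv.combo_self_interior_mem_interior hx₀T hx₁ (a := 1 - t) (b := t)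
      (by linarith [ht.2]) ht.1 (by ring)
    rw [hΔ]
    convert h using 1
    module
  refine ⟨x₁, hΔ ▸ hx₁, ?_⟩
  have hg : ConvexOn ℝ (Icc 0 1) fun t : ℝ => u (x₀ + t • (x₁ - x₀)) := by
    have h := hconv.comp_affineMap (AffineMap.lineMap x₀ x₁ : ℝ →ᵃ[ℝ] En 2)
    refine (h.subset ?_ (convex_Icc 0 1)).congr fun t _ => ?_
    · intro t ht
      rw [mem_preimage, hcl]
      exact hTconv.lineMap_mem hx₀T (interior_subset hx₁) ht
    · simp [AffineMap.lineMap_apply, add_comm]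
  have := hg.exists_tendsto_div_nhdsGT_zero (m := -⟪x₁ - x₀, L⟫) fun t ht => by
    have h := hcomp _ (hmem t ht)
    rw [add_sub_cancel_left, real_inner_smul_left] at h
    rw [le_div_iff₀ ht.1]
    simp only [zero_smul, add_zero, hux₀, sub_zero]
    linarith
  simpa using this
end
end
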